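/- For every N ∈ ℕ, the simple random walk Z on the infinite pre-Sierpinski gasket started at O satisfies P[Z(T_1^N) = a_N] = 1/4 and P[Z(T_1^N) = b_N and Z(T_2^N) = a_N] = 1/16. -/

import Mathlib

/-!  Loop-erased random walks on the pre-Sierpinski gasket
     (K. Hattori - M. Mizuno, "Loop-erased random walk on the Sierpinski gasket").

     Common definitions: the pre-Sierpinski gasket, finite random-walk paths,
     hitting times, coarse graining, skeletons, the larger-scale-loops-first
     loop-erasing procedure, the associated generating functions, and the
     scaled (continuum) setting on the finite Sierpinski gasket. -/

open scoped Classical NNReal ENNReal Topology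
open MeasureTheory Filter Set

noncomputable section

namespace LERW

/-! ### The pre-Sierpinski gasket -/

/-- Points of the plane. -/
abbrev Pt : Type := ℝ × ℝ

/-- The origin `O`. -/
def ptO : Pt := (0, 0)

/-- `a_N = 2^N (1/2, √3/2)`. -/
def ptA (N : ℕ) : Pt := ((2:ℝ)^N * (1/2), (2:ℝ)^N * (Real.sqrt 3 / 2))

/-- `b_N = 2^N (1, 0)`. -/
def ptB (N : ℕ) : Pt := ((2:ℝ)^N, 0)

/-- Vertices of the graph `F'_N`. -/
def preVerts : ℕ → Set Pt
  | 0 => {ptO, ptA 0, ptB 0}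
  | N+1 => preVerts N ∪ ((· + ptA N) '' preVerts N) ∪ ((· + ptB N) '' preVerts N)

/-- Edges of the graph `F'_N` (as a symmetric set of ordered pairs). -/
def preEdges : ℕ → Set (Pt × Pt)
  | 0 => {(ptO, ptA 0), (ptA 0, ptO), (ptO, ptB 0), (ptB 0, ptO), (ptA 0, ptB 0), (ptB 0, ptA 0)}
  | N+1 => preEdges N ∪ ((fun e => (e.1 + ptA N, e.2 + ptA N)) '' preEdges N)
      ∪ ((fun e => (e.1 + ptB N, e.2 + ptB N)) '' preEdges N)

/-- Reflection with respect to the `y`-axis. -/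
def reflY (p : Pt) : Pt := (-p.1, p.2)

/-- `G_0`: the vertex set of the infinite pre-Sierpinski gasket `F_0`. -/
def G0 : Set Pt := ⋃ N, (preVerts N ∪ reflY '' preVerts N)

/-- `E_0`: the edge set of the infinite pre-Sierpinski gasket `F_0`. -/
def E0 : Set (Pt × Pt) := ⋃ N, (preEdges N ∪ (fun e => (reflY e.1, reflY e.2)) '' preEdges N)

/-- `G_M = 2^M G_0`: the vertex set of the coarse graph `F_M`. -/
def G (M : ℕ) : Set Pt := (fun p : Pt => ((2:ℝ)^M) • p) '' G0

/-! ### Finite paths on the pre-Sierpinski gasket -/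

/-- A finite path `(w(0), w(1), …, w(len))`, recorded as a function `ℕ → Pt`
which is (by convention) frozen at its final value after time `len`. -/
structure Path where
  X : ℕ → Pt
  len : ℕ

/-- `w` is a finite nearest-neighbour walk on `F_0` starting at `O`,
stopped at time `w.len`. -/
def IsWalk (w : Path) : Prop :=
  w.X 0 = ptO ∧ (∀ i, i ≤ w.len → w.X i ∈ G0) ∧
    (∀ i, i < w.len → (w.X i, w.X (i+1)) ∈ E0) ∧ (∀ i, w.len ≤ i → w.X i = w.X w.len)

/-- `hitT M w i = T_i^M(w)`, the successive hitting times of `G_M`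
(hitting the same vertex several times in a row is counted once). -/
def hitT (M : ℕ) (w : Path) : ℕ → ℕ
  | 0 => sInf {j | w.X j ∈ G M}
  | i+1 => sInf {j | hitT M w i < j ∧ w.X j ∈ G M ∧ w.X j ≠ w.X (hitT M w i)}

/-- `W_N`: finite walks from `O` to `a_N` which hit no other vertex of `G_N` on the way. -/
def WSet (N : ℕ) : Set Path :=
  {w | IsWalk w ∧ w.X w.len = ptA N ∧ w.len = hitT N w 1}

/-- `V_N`: finite walks from `O` to `a_N` hitting `b_N` (once) on the way. -/
def VSet (N : ℕ) : Set Path :=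
  {w | IsWalk w ∧ w.X (hitT N w 1) = ptB N ∧ w.X w.len = ptA N ∧ w.len = hitT N w 2}

/-- Probability of the cylinder of a simple-random-walk path (`(1/4)^length`). -/
def rwWeight (w : Path) : ℝ := (1/4 : ℝ) ^ w.len

/-- `P_N[w] = (1/4)^{ℓ(w)} / (1/4)`: mass of `w ∈ W_N` under the conditioned walk `X_N`. -/
def PW (w : Path) : ℝ := 4 * (1/4 : ℝ) ^ w.len

/-- `P'_N[w] = (1/4)^{ℓ(w)} / (1/16)`: mass of `w ∈ V_N` under the conditioned walk `X'_N`. -/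
def PV (w : Path) : ℝ := 16 * (1/4 : ℝ) ^ w.len

/-- Self-avoiding paths. -/
def SelfAvoiding (w : Path) : Prop :=
  ∀ i j, i ≤ w.len → j ≤ w.len → w.X i = w.X j → i = j

/-- `Ŵ_N`: the self-avoiding elements of `W_N`. -/
def WHat (N : ℕ) : Set Path := {w | w ∈ WSet N ∧ SelfAvoiding w}

/-- `V̂_N`: the self-avoiding elements of `V_N`. -/
def VHat (N : ℕ) : Set Path := {w | w ∈ VSet N ∧ SelfAvoiding w}

/-- Spatial rescaling of a path by a factor `c`. -/
def scalePath (c : ℝ) (w : Path) : Path := ⟨fun i => c • w.X i, w.len⟩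

/-! ### Coarse graining -/

/-- The number of coarse steps of `w` at scale `2^M`. -/
def coarseLen (M : ℕ) (w : Path) : ℕ := sInf {i | hitT M w i = w.len}

/-- `Q_M w`: the coarse-grained path `(w(T_0^M), w(T_1^M), …)` on the graph `F_M`. -/
def coarse (M : ℕ) (w : Path) : Path :=
  ⟨fun i => w.X (hitT M w (min i (coarseLen M w))), coarseLen M w⟩

/-! ### `2^M`-triangles and skeletons -/

/-- The vertices of the upward `2^M`-triangle with base point `z`. -/
def triVerts (M : ℕ) (z : Pt) : Set Pt := {z, z + ptA M, z + ptB M}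

/-- The (closed, filled) upward `2^M`-triangle with base point `z`. -/
def triSet (M : ℕ) (z : Pt) : Set Pt := convexHull ℝ (triVerts M z)

/-- `z` is the base point of an upward `2^M`-triangle with vertices in `G_M`. -/
def IsTriBase (M : ℕ) (z : Pt) : Prop :=
  z ∈ G M ∧ z + ptA M ∈ G M ∧ z + ptB M ∈ G M

/-- The base point of the (unique) upward `2^M`-triangle having both `x` and `y`
among its vertices. -/
def triOf (M : ℕ) (x y : Pt) : Pt :=
  Classical.epsilon fun z => IsTriBase M z ∧ x ∈ triVerts M z ∧ y ∈ triVerts M z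

/-- `skel M w i = (T_i^{ex,M}(w), base point of Δ_{i+1})`: the exit times from, and the
base points of, the successive `2^M`-triangles of the skeleton `σ_M(w)`. -/
def skel (M : ℕ) (w : Path) : ℕ → ℕ × Pt
  | 0 => (hitT M w 0, triOf M (w.X (hitT M w 0)) (w.X (hitT M w 1)))
  | i+1 =>
    let e := (skel M w i).1
    let z := (skel M w i).2
    let jj := sInf {j | e < hitT M w j ∧ w.X (hitT M w (j+1)) ∉ triSet M z}
    (hitT M w jj, triOf M (w.X (hitT M w jj)) (w.X (hitT M w (jj+1))))

/-- `T_i^{ex,M}(w)`: exit time from the `i`-th triangle of the skeleton (`exitT M w 0 = T_0^M`). -/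
def exitT (M : ℕ) (w : Path) (i : ℕ) : ℕ := (skel M w i).1

/-- Base point of the triangle `Δ_{i+1}` of the skeleton `σ_M(w)` (`i = 0, 1, …`). -/
def triBase (M : ℕ) (w : Path) (i : ℕ) : Pt := (skel M w i).2

/-- The number `k` of triangles in the skeleton `σ_M(w)`. -/
def numTri (M : ℕ) (w : Path) : ℕ := sInf {k | exitT M w k = w.len}

/-- The index `n` with `T_n^M(w) = T_i^{ex,M}(w)` (entrance index of `Δ_{i+1}`). -/
def entIdx (M : ℕ) (w : Path) (i : ℕ) : ℕ := sInf {n | hitT M w n = exitT M w i}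

/-- The triangle `Δ_{i+1}` of `σ_M(w)` is of Type 1 (crossed in one `G_M`-hitting step). -/
def IsType1 (M : ℕ) (w : Path) (i : ℕ) : Prop :=
  exitT M w (i+1) = hitT M w (entIdx M w i + 1)

/-- The triangle `Δ_{i+1}` of `σ_M(w)` is of Type 2 (crossed in two `G_M`-hitting steps). -/
def IsType2 (M : ℕ) (w : Path) (i : ℕ) : Prop :=
  exitT M w (i+1) = hitT M w (entIdx M w i + 2)

/-- `s_1(w)` at scale `M`: the number of Type 1 triangles of `σ_M(w)`. -/
def s1 (M : ℕ) (w : Path) : ℕ :=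
  ((Finset.range (numTri M w)).filter fun i => IsType1 M w i).card

/-- `s_2(w)` at scale `M`: the number of Type 2 triangles of `σ_M(w)`. -/
def s2 (M : ℕ) (w : Path) : ℕ :=
  ((Finset.range (numTri M w)).filter fun i => IsType2 M w i).card

/-- Equality of the `2^K`-skeletons of two paths. -/
def SkelEq (K : ℕ) (u v : Path) : Prop :=
  numTri K u = numTri K v ∧ ∀ i, i < numTri K u → triBase K u i = triBase K v i

/-! ### The larger-scale-loops-first loop-erasing procedure -/

/-- Last-exit times `s_0, s_1, …` of the loop-erasing rule, applied to the coarse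
(scale `2^m`) path of `w` between the coarse indices `a` and `b`. -/
def lee (m : ℕ) (w : Path) (a b : ℕ) : ℕ → ℕ
  | 0 => sSup {j | a ≤ j ∧ j ≤ b ∧ w.X (hitT m w j) = w.X (hitT m w a)}
  | i+1 => sSup {j | a ≤ j ∧ j ≤ b ∧ w.X (hitT m w j) = w.X (hitT m w (lee m w a b i + 1))}

/-- The number of coarse steps of the loop-erased coarse path of the window `[a, b]`. -/
def leeLen (m : ℕ) (w : Path) (a b : ℕ) : ℕ := sInf {i | lee m w a b i = b}

/-- The retained segments of the original path `w` (between the coarse last-exit times of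
the window `[a, b]` at scale `2^m`), concatenated; the final point is omitted. -/
def windowList (m : ℕ) (w : Path) (a b : ℕ) : List Pt :=
  (((List.range (leeLen m w a b)).map fun i =>
    (List.range' (hitT m w (lee m w a b i))
      (hitT m w (lee m w a b i + 1) - hitT m w (lee m w a b i))).map w.X)).flatten

/-- The path determined by a (nonempty) list of points. -/
def ofList (l : List Pt) : Path :=
  ⟨fun i => l.getD (min i (l.length - 1)) ptO, l.length - 1⟩

/-- The coarse index (at scale `2^m`) of an original time `t`. -/
def idxOf (m : ℕ) (w : Path) (t : ℕ) : ℕ := sInf {j | hitT m w j = t}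

/-- One step of the loop-erasing procedure: erase all `2^m`-scale loops of `w`
(all larger-scale loops being already erased), by erasing, within each triangle
of the skeleton `σ_{m+1}(w)`, the loops of the scale-`2^m` coarse path by the
last-exit rule and concatenating the corresponding retained segments of `w`. -/
def eraseScale (m : ℕ) (w : Path) : Path :=
  ofList (((((List.range (numTri (m+1) w)).map fun i =>
      windowList m w (idxOf m w (exitT (m+1) w i)) (idxOf m w (exitT (m+1) w (i+1))))).flatten)
    ++ [w.X w.len])

/-- Erase the loops of the `t` largest scales `2^{N-1}, 2^{N-2}, …, 2^{N-t}`,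
larger scales first. -/
def eraseTop (N : ℕ) (w : Path) : ℕ → Path
  | 0 => w
  | t+1 => eraseScale (N - 1 - t) (eraseTop N w t)

/-- The loop erasure `L w` of a path `w ∈ W_N ∪ V_N`. -/
def loopErase (N : ℕ) (w : Path) : Path := eraseTop N w N

/-- The path obtained from `w ∈ W_N ∪ V_N` once all loops of scale `≥ 2^M` are erased. -/
def partialLE (N M : ℕ) (w : Path) : Path := eraseTop N w (N - M)

/-- `Q̂_M w`: the loop-free coarse path on `F_M` obtained from `w ∈ W_N ∪ V_N` once all
loops of scale `≥ 2^M` have been erased. -/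
def Qhat (N M : ℕ) (w : Path) : Path := coarse M (partialLE N M w)

/-! ### Generating functions and the mean matrix -/

/-- `Φ_N(x,y) = Σ_{w ∈ Ŵ_N} P̂_N(w) x^{s_1(w)} y^{s_2(w)}
             = E[x^{s_1(L X_N)} y^{s_2(L X_N)}]`. -/
def PhiN (N : ℕ) (x y : ℝ) : ℝ :=
  ∑' w : WSet N, PW w.1 * x ^ s1 0 (loopErase N w.1) * y ^ s2 0 (loopErase N w.1)

/-- `Θ_N(x,y) = Σ_{w ∈ V̂_N} P̂'_N(w) x^{s_1(w)} y^{s_2(w)}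
             = E[x^{s_1(L X'_N)} y^{s_2(L X'_N)}]`. -/
def ThetaN (N : ℕ) (x y : ℝ) : ℝ :=
  ∑' w : VSet N, PV w.1 * x ^ s1 0 (loopErase N w.1) * y ^ s2 0 (loopErase N w.1)

/-- The polynomial `Φ(x,y) = (15x² + 8xy + y² + 2x²y + 4x³)/30`. -/
def PhiPoly (x y : ℝ) : ℝ := (15*x^2 + 8*x*y + y^2 + 2*x^2*y + 4*x^3) / 30

/-- The polynomial `Θ(x,y) = (5x² + 11xy + 2y² + 14x²y + 8x³ + 5xy²)/45`. -/
def ThetaPoly (x y : ℝ) : ℝ := (5*x^2 + 11*x*y + 2*y^2 + 14*x^2*y + 8*x^3 + 5*x*y^2) / 45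

/-- The complexification of `Φ`. -/
def PhiPolyC (x y : ℂ) : ℂ := (15*x^2 + 8*x*y + y^2 + 2*x^2*y + 4*x^3) / 30

/-- The complexification of `Θ`. -/
def ThetaPolyC (x y : ℂ) : ℂ := (5*x^2 + 11*x*y + 2*y^2 + 14*x^2*y + 8*x^3 + 5*x*y^2) / 45

/-- The mean matrix `M = [[9/5, 2/15], [26/15, 13/15]]`. -/
def meanMat : Matrix (Fin 2) (Fin 2) ℝ := !![9/5, 2/15; 26/15, 13/15]

/-- `λ = (20 + √205)/15`, the largest eigenvalue of the mean matrix. -/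
def lamR : ℝ := (20 + Real.sqrt 205) / 15

/-- The law of `λ^{-N} ℓ(L X_N)` (as a measure on `ℝ`). -/
def lawLen (N : ℕ) : Measure ℝ :=
  Measure.sum fun w : WSet N =>
    ENNReal.ofReal (PW w.1) • Measure.dirac ((lamR ^ N)⁻¹ * ((loopErase N w.1).len : ℝ))

/-! ### Identification of path segments -/

/-- Euclidean distance in the plane. -/
def euclDist (p q : Pt) : ℝ := Real.sqrt ((p.1 - q.1)^2 + (p.2 - q.2)^2)

/-- `f` is a Euclidean isometry of the plane (a composition of a translation,
a rotation and possibly a reflection). -/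
def IsEuclIsom (f : Pt → Pt) : Prop := ∀ p q, euclDist (f p) (f q) = euclDist p q

/-- The walk segment of `w` between its `i`-th and `(i+1)`-st hitting times of `G_M`,
identified - via a plane isometry sending its entrance vertex to `O` and its exit vertex
to `a_K` - with the path `u`. -/
def SegMatch (K M : ℕ) (w : Path) (i : ℕ) (u : Path) : Prop :=
  ∃ η : Pt → Pt, IsEuclIsom η ∧ η (w.X (hitT M w i)) = ptO ∧
    η (w.X (hitT M w (i+1))) = ptA K ∧
    u.len = hitT M w (i+1) - hitT M w i ∧
    ∀ t, hitT M w i ≤ t → t ≤ hitT M w (i+1) → η (w.X t) = u.X (t - hitT M w i)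

/-- The traverse time of the `(i+1)`-st triangle of the skeleton `σ_M(u)`. -/
def travTime (M : ℕ) (u : Path) (i : ℕ) : ℕ := exitT M u (i+1) - exitT M u i

/-- The skeleton of `u` at scale `2^M` consists of `k` triangles with base points
`base 0, …, base (k-1)` and types `typ 0, …, typ (k-1)` (`true` = Type 1). -/
def SkelData (M : ℕ) (u : Path) (k : ℕ) (base : ℕ → Pt) (typ : ℕ → Bool) : Prop :=
  numTri M u = k ∧ ∀ i, i < k →
    triBase M u i = base i ∧ (if typ i then IsType1 M u i else IsType2 M u i)

/-! ### The scaled setting: paths on the finite Sierpinski gasket -/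

/-- Continuous-time paths in the plane (the ambient space of the path space `C`). -/
abbrev PathFun : Type := ℝ≥0 → Pt

/-- Linear interpolation of a finite path. -/
def interp (w : Path) (t : ℝ) : Pt :=
  (1 - (t - (⌊t⌋₊ : ℝ))) • w.X ⌊t⌋₊ + (t - (⌊t⌋₊ : ℝ)) • w.X (⌊t⌋₊ + 1)

/-- The element of the continuous path space corresponding to `2^{-N} w`
(one time unit per lattice step). -/
def embedSc (N : ℕ) (w : Path) : PathFun := fun t => (((2:ℝ)^N)⁻¹) • interp w (t : ℝ)

/-- `Ŵ^N = 2^{-N} Ŵ_N`, as a set of continuous paths. -/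
def WHatSc (N : ℕ) : Set PathFun := {f | ∃ w, w ∈ WHat N ∧ f = embedSc N w}

/-- `Q^i v` for `v = 2^{-N} w ∈ W^N`: the coarse-grained path at scale `2^{-i}`. -/
def QSc (N i : ℕ) (w : Path) : PathFun := embedSc N (coarse (N - i) w)

/-- `Q̂^i v` for `v = 2^{-N} w ∈ W^N`: the loop-free coarse path at scale `2^{-i}`
(all loops of scale `≥ 2^{-i}` erased). -/
def QhatSc (N i : ℕ) (w : Path) : PathFun := embedSc N (Qhat N (N - i) w)

/-- The relation `w_N ▷ w_{N+1}`. -/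
def TriRel (N : ℕ) (a u : PathFun) : Prop :=
  ∃ v : Path, v ∈ WSet (N+1) ∧ a = QSc (N+1) N v ∧ u = QhatSc (N+1) (N+1) v

/-- `Ω'`: the set of consistent sequences `(w_0, w_1, w_2, …)`. -/
def GoodSeq : Set (ℕ → PathFun) :=
  {ω | (∀ N, ω N ∈ WHatSc N) ∧ ∀ N, TriRel N (ω N) (ω (N+1))}

/-- `P̂^N`: the joint law of `(Q̂^0 v, Q̂^1 v, …, Q̂^N v)` under the conditioned
random-walk law `P^N` on `W^N`. -/
def hatP (N : ℕ) : Measure (Fin (N+1) → PathFun) :=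
  Measure.sum fun w : WSet N =>
    ENNReal.ofReal (PW w.1) • Measure.dirac fun i : Fin (N+1) => QhatSc N i w.1

/-- The projection `π_N` onto the first `N+1` coordinates. -/
def projN (N : ℕ) (ω : ℕ → PathFun) : Fin (N+1) → PathFun := fun i => ω i

/-- `P` is the Kolmogorov-extension measure `P̂` of the projective family `(P̂^N)`:
a probability measure carried by `Ω'` whose finite-dimensional projections are the
laws `P̂^N` of the successive partial loop erasures of the conditioned walks. -/
def IsScalingLimitLaw (P : Measure (ℕ → PathFun)) : Prop :=
  IsProbabilityMeasure P ∧ P GoodSeq = 1 ∧ ∀ N, Measure.map (projN N) P = hatP N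

/-! ### The finite Sierpinski gasket and continuous-path skeletons -/

/-- The closed unit triangle `Δ_1` with vertices `O`, `a_0`, `b_0`. -/
def Delta1 : Set Pt := convexHull ℝ {ptO, ptA 0, ptB 0}

/-- Its reflection `Δ_2` in the `y`-axis. -/
def Delta2 : Set Pt := reflY '' Delta1

/-- `G^N = 2^{-N} G_0 ∩ (Δ_1 ∪ Δ_2)`. -/
def GFin (N : ℕ) : Set Pt :=
  ((fun p : Pt => (((2:ℝ)^N)⁻¹) • p) '' G0) ∩ (Delta1 ∪ Delta2)

/-- The finite Sierpinski gasket `F`. -/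
def Gasket : Set Pt := closure (⋃ N, GFin N)

/-- Successive hitting times of `G^M` by a continuous path. -/
def hitTC (M : ℕ) (w : PathFun) : ℕ → ℝ≥0
  | 0 => sInf {t | w t ∈ GFin M}
  | i+1 => sInf {t | hitTC M w i < t ∧ w t ∈ GFin M ∧ w t ≠ w (hitTC M w i)}

/-- Vertices of the upward `2^{-M}`-triangle with base point `z`. -/
def triVertsC (M : ℕ) (z : Pt) : Set Pt :=
  {z, z + (((2:ℝ)^M)⁻¹) • ptA 0, z + (((2:ℝ)^M)⁻¹) • ptB 0}

/-- The (closed, filled) upward `2^{-M}`-triangle with base point `z`. -/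
def triSetC (M : ℕ) (z : Pt) : Set Pt := convexHull ℝ (triVertsC M z)

/-- `z` is the base point of an upward `2^{-M}`-triangle with vertices in `G^M`. -/
def IsTriBaseC (M : ℕ) (z : Pt) : Prop :=
  z ∈ GFin M ∧ z + (((2:ℝ)^M)⁻¹) • ptA 0 ∈ GFin M ∧ z + (((2:ℝ)^M)⁻¹) • ptB 0 ∈ GFin M

/-- The base point of the (unique) upward `2^{-M}`-triangle having both `x` and `y`
among its vertices. -/
def triOfC (M : ℕ) (x y : Pt) : Pt :=
  Classical.epsilon fun z => IsTriBaseC M z ∧ x ∈ triVertsC M z ∧ y ∈ triVertsC M z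

/-- Exit times and triangle base points of the skeleton `σ^M(w)` of a continuous path. -/
def skelC (M : ℕ) (w : PathFun) : ℕ → ℝ≥0 × Pt
  | 0 => (hitTC M w 0, triOfC M (w (hitTC M w 0)) (w (hitTC M w 1)))
  | i+1 =>
    let e := (skelC M w i).1
    let z := (skelC M w i).2
    let jj := sInf {j : ℕ | e < hitTC M w j ∧ w (hitTC M w (j+1)) ∉ triSetC M z}
    (hitTC M w jj, triOfC M (w (hitTC M w jj)) (w (hitTC M w (jj+1))))

/-- `T_i^{ex,M}(w)` for a continuous path `w`. -/
def exitTC (M : ℕ) (w : PathFun) (i : ℕ) : ℝ≥0 := (skelC M w i).1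

/-- Base point of the triangle `Δ_{i+1}` of the skeleton `σ^M(w)` (`i = 0, 1, …`). -/
def triBaseC (M : ℕ) (w : PathFun) (i : ℕ) : Pt := (skelC M w i).2

/-- The arrival time at `a_0`. -/
def arrTC (w : PathFun) : ℝ≥0 := sInf {t | w t = ptA 0}

/-- The number of triangles in the skeleton `σ^M(w)`. -/
def numTriC (M : ℕ) (w : PathFun) : ℕ := sInf {k | exitTC M w k = arrTC w}

/-- Entrance hitting-index of the triangle `Δ_{i+1}` of `σ^M(w)`. -/
def entIdxC (M : ℕ) (w : PathFun) (i : ℕ) : ℕ := sInf {n | hitTC M w n = exitTC M w i}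

/-- The triangle `Δ_{i+1}` of `σ^M(w)` is of Type 1. -/
def IsType1C (M : ℕ) (w : PathFun) (i : ℕ) : Prop :=
  exitTC M w (i+1) = hitTC M w (entIdxC M w i + 1)

/-- The triangle `Δ_{i+1}` of `σ^M(w)` is of Type 2. -/
def IsType2C (M : ℕ) (w : PathFun) (i : ℕ) : Prop :=
  exitTC M w (i+1) = hitTC M w (entIdxC M w i + 2)

/-- The number of Type 1 triangles of the skeleton `σ^M(w)` contained in the region `A`
(the count `S_1^M(w|_A)`). -/
def S1in (M : ℕ) (A : Set Pt) (w : PathFun) : ℕ :=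
  ((Finset.range (numTriC M w)).filter fun i =>
    IsType1C M w i ∧ triSetC M (triBaseC M w i) ⊆ A).card

/-- The number of Type 2 triangles of the skeleton `σ^M(w)` contained in the region `A`
(the count `S_2^M(w|_A)`). -/
def S2in (M : ℕ) (A : Set Pt) (w : PathFun) : ℕ :=
  ((Finset.range (numTriC M w)).filter fun i =>
    IsType2C M w i ∧ triSetC M (triBaseC M w i) ⊆ A).card

/-- Equality of the `2^{-M}`-skeletons of two continuous paths. -/
def SkelCEq (M : ℕ) (u v : PathFun) : Prop :=
  numTriC M u = numTriC M v ∧ ∀ i, i < numTriC M u → triBaseC M u i = triBaseC M v i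

/-- The time-scaled process `X^N(t) = Y^N(λ^N t)`. -/
def Xproc (N : ℕ) (ω : ℕ → PathFun) : PathFun := fun t => ω N ((lamR ^ N).toNNReal * t)

/-- The conditional probability `P̂[ · | Y^M = v]`. -/
def condY (P : Measure (ℕ → PathFun)) (M : ℕ) (v : PathFun) : Measure (ℕ → PathFun) :=
  ProbabilityTheory.cond P {ω | ω M = v}

/-- The region of the plane occupied by the triangle `Δ_{i+1}` of `σ^M(v)`. -/
def triRegion (M : ℕ) (v : PathFun) (i : ℕ) : Set Pt := triSetC M (triBaseC M v i)

/-- `S^K(Y^K|_A) = (S_1^K(Y^K|_A), S_2^K(Y^K|_A))` as a function of `ω`. -/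
def SvecY (K : ℕ) (A : Set Pt) (ω : ℕ → PathFun) : ℕ × ℕ :=
  (S1in K A (ω K), S2in K A (ω K))

/-- `S^K(X^K|_A) = (S_1^K(X^K|_A), S_2^K(X^K|_A))` as a function of `ω`. -/
def SvecX (K : ℕ) (A : Set Pt) (ω : ℕ → PathFun) : ℕ × ℕ :=
  (S1in K A (Xproc K ω), S2in K A (Xproc K ω))

/-- The Laplace transform `φ(z) = Ê[exp(z B)]`, as a function on `ℂ`. -/
def laplaceT (P : Measure (ℕ → PathFun)) (B : (ℕ → PathFun) → ℝ) (z : ℂ) : ℂ :=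
  ∫ ω, Complex.exp (z * (B ω : ℂ)) ∂P


/-! ### Lattice coordinates -/

/-- The coordinate along `a_0` in the basis `(a_0, b_0)`. -/
def coordA (p : Pt) : ℝ := 2 * p.2 / Real.sqrt 3

/-- The coordinate along `b_0` in the basis `(a_0, b_0)`. -/
def coordB (p : Pt) : ℝ := p.1 - p.2 / Real.sqrt 3

@[simp] lemma coordA_add (p q : Pt) : coordA (p + q) = coordA p + coordA q := by
  simp only [coordA, Prod.snd_add]; ring

@[simp] lemma coordB_add (p q : Pt) : coordB (p + q) = coordB p + coordB q := by
  simp only [coordB, Prod.snd_add, Prod.fst_add]; ring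

@[simp] lemma coordA_sub (p q : Pt) : coordA (p - q) = coordA p - coordA q := by
  simp only [coordA, Prod.snd_sub]; ring

@[simp] lemma coordB_sub (p q : Pt) : coordB (p - q) = coordB p - coordB q := by
  simp only [coordB, Prod.snd_sub, Prod.fst_sub]; ring

@[simp] lemma coordA_smul (c : ℝ) (p : Pt) : coordA (c • p) = c * coordA p := by
  simp only [coordA, Prod.smul_snd, smul_eq_mul]; ring

@[simp] lemma coordB_smul (c : ℝ) (p : Pt) : coordB (c • p) = c * coordB p := by
  simp only [coordB, Prod.smul_snd, Prod.smul_fst, smul_eq_mul]; ring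

@[simp] lemma coordA_ptO : coordA ptO = 0 := by simp [coordA, ptO]

@[simp] lemma coordB_ptO : coordB ptO = 0 := by simp [coordB, ptO]

@[simp] lemma coordA_ptA (N : ℕ) : coordA (ptA N) = 2 ^ N := by
  have : Real.sqrt 3 ≠ 0 := by positivity
  simp only [coordA, ptA]; field_simp

@[simp] lemma coordB_ptA (N : ℕ) : coordB (ptA N) = 0 := by
  have : Real.sqrt 3 ≠ 0 := by positivity
  simp only [coordB, ptA]; field_simp; ring

@[simp] lemma coordA_ptB (N : ℕ) : coordA (ptB N) = 0 := by simp [coordA, ptB]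

@[simp] lemma coordB_ptB (N : ℕ) : coordB (ptB N) = 2 ^ N := by simp [coordB, ptB]

@[simp] lemma coordA_reflY (p : Pt) : coordA (reflY p) = coordA p := rfl

@[simp] lemma coordB_reflY (p : Pt) : coordB (reflY p) = -coordB p - coordA p := by
  simp only [coordA, coordB, reflY]; ring

lemma ext_coord {p q : Pt} (hA : coordA p = coordA q) (hB : coordB p = coordB q) : p = q := by
  have h3 : Real.sqrt 3 ≠ 0 := by positivity
  have h2 : p.2 = q.2 := by
    simp only [coordA] at hA; field_simp at hA; linarith
  have h1 : p.1 = q.1 := by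
    simp only [coordB, h2] at hB; linarith
  exact Prod.ext h1 h2

@[simp] lemma reflY_reflY (p : Pt) : reflY (reflY p) = p := by simp [reflY]

lemma reflY_injective : Function.Injective reflY := Function.LeftInverse.injective reflY_reflY

@[simp] lemma reflY_ptO : reflY ptO = ptO := by simp [reflY, ptO]

lemma ptO_eq_zero : ptO = 0 := rfl

lemma ptA_succ (N : ℕ) : ptA (N + 1) = ptA N + ptA N :=
  ext_coord (by simp; ring) (by simp)

lemma ptB_succ (N : ℕ) : ptB (N + 1) = ptB N + ptB N :=
  ext_coord (by simp) (by simp; ring)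

lemma smul_ptA (N : ℕ) : ((2 : ℝ) ^ N) • ptA 0 = ptA N := ext_coord (by simp) (by simp)

lemma smul_ptB (N : ℕ) : ((2 : ℝ) ^ N) • ptB 0 = ptB N := ext_coord (by simp) (by simp)

/-! ### Vertices and edges of the finite graphs -/

lemma exists_coord_of_mem_preVerts {N : ℕ} {p : Pt} (hp : p ∈ preVerts N) :
    ∃ i j : ℕ, coordA p = i ∧ coordB p = j ∧ i + j ≤ 2 ^ N := by
  induction N generalizing p with
  | zero =>
    rcases hp with rfl | rfl | rfl
    · exact ⟨0, 0, by simp⟩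
    · exact ⟨1, 0, by simp⟩
    · exact ⟨0, 1, by simp⟩
  | succ N ih =>
    rcases hp with (hp | ⟨q, hq, rfl⟩) | ⟨q, hq, rfl⟩
    · obtain ⟨i, j, hi, hj, h⟩ := ih hp
      exact ⟨i, j, hi, hj, h.trans (Nat.pow_le_pow_right (by norm_num) N.le_succ)⟩
    · obtain ⟨i, j, hi, hj, h⟩ := ih hq
      exact ⟨i + 2 ^ N, j, by simp [hi], by simp [hj], by rw [pow_succ]; omega⟩
    · obtain ⟨i, j, hi, hj, h⟩ := ih hq
      exact ⟨i, j + 2 ^ N, by simp [hi], by simp [hj], by rw [pow_succ]; omega⟩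

lemma coord_bounds {N : ℕ} {p : Pt} (hp : p ∈ preVerts N) :
    0 ≤ coordA p ∧ 0 ≤ coordB p ∧ coordA p + coordB p ≤ 2 ^ N := by
  obtain ⟨i, j, hi, hj, h⟩ := exists_coord_of_mem_preVerts hp
  rw [hi, hj]
  exact ⟨by positivity, by positivity, by exact_mod_cast h⟩

/-- `p` is one of the three corners of `F'_N`. -/
def IsCorner (N : ℕ) (p : Pt) : Prop := p = ptO ∨ p = ptA N ∨ p = ptB N

lemma ptO_mem_preVerts (N : ℕ) : ptO ∈ preVerts N := by
  induction N with
  | zero => exact Or.inl rfl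
  | succ N ih => exact Or.inl (Or.inl ih)

lemma ptA_mem_preVerts (N : ℕ) : ptA N ∈ preVerts N := by
  induction N with
  | zero => exact Or.inr (Or.inl rfl)
  | succ N ih => exact Or.inl (Or.inr ⟨_, ih, (ptA_succ N).symm⟩)

lemma ptB_mem_preVerts (N : ℕ) : ptB N ∈ preVerts N := by
  induction N with
  | zero => exact Or.inr (Or.inr rfl)
  | succ N ih => exact Or.inr ⟨_, ih, (ptB_succ N).symm⟩

lemma preVerts_mono : Monotone preVerts :=
  monotone_nat_of_le_succ fun _ _ hx => Or.inl (Or.inl hx)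

lemma preEdges_mono : Monotone preEdges :=
  monotone_nat_of_le_succ fun _ _ hx => Or.inl (Or.inl hx)

lemma of_mem_preEdges {N : ℕ} {e : Pt × Pt} (he : e ∈ preEdges N) :
    e.1 ∈ preVerts N ∧ e.2 ∈ preVerts N ∧ e.1 ≠ e.2 := by
  induction N generalizing e with
  | zero =>
    have hOA : ptO ≠ ptA 0 := fun h => by simpa using congrArg coordA h
    have hOB : ptO ≠ ptB 0 := fun h => by simpa using congrArg coordB h
    have hAB : ptA 0 ≠ ptB 0 := fun h => by simpa using congrArg coordA h
    rcases he with rfl | rfl | rfl | rfl | rfl | rfl <;>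
      simp [preVerts, hOA, hOB, hAB, hOA.symm, hOB.symm, hAB.symm]
  | succ N ih =>
    rcases he with (he | ⟨e, he, rfl⟩) | ⟨e, he, rfl⟩
    · obtain ⟨h1, h2, h3⟩ := ih he
      exact ⟨Or.inl (Or.inl h1), Or.inl (Or.inl h2), h3⟩
    · obtain ⟨h1, h2, h3⟩ := ih he
      exact ⟨Or.inl (Or.inr ⟨_, h1, rfl⟩), Or.inl (Or.inr ⟨_, h2, rfl⟩), by simpa using h3⟩
    · obtain ⟨h1, h2, h3⟩ := ih he
      exact ⟨Or.inr ⟨_, h1, rfl⟩, Or.inr ⟨_, h2, rfl⟩, by simpa using h3⟩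

lemma preEdges_finite (N : ℕ) : (preEdges N).Finite := by
  induction N with
  | zero => simp [preEdges]
  | succ N ih => exact (ih.union (ih.image _)).union (ih.image _)

lemma nbr_finite (N : ℕ) (x : Pt) : {y | (x, y) ∈ preEdges N}.Finite :=
  ((preEdges_finite N).image Prod.snd).subset fun y hy => ⟨(x, y), hy, rfl⟩

/-- The neighbours of `x` in the graph `F'_N`. -/
def nbr (N : ℕ) (x : Pt) : Finset Pt := (nbr_finite N x).toFinset

@[simp] lemma mem_nbr {N : ℕ} {x y : Pt} : y ∈ nbr N x ↔ (x, y) ∈ preEdges N := by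
  simp [nbr]

lemma nbr_eq_empty {N : ℕ} {x : Pt} (hx : x ∉ preVerts N) : nbr N x = ∅ :=
  Finset.eq_empty_of_forall_notMem fun _ hy => hx (of_mem_preEdges (mem_nbr.1 hy)).1

lemma nbr_succ (N : ℕ) (x : Pt) :
    nbr (N + 1) x = (nbr N x ∪ (nbr N (x - ptA N)).map (addRightEmbedding (ptA N))) ∪
      (nbr N (x - ptB N)).map (addRightEmbedding (ptB N)) := by
  ext y
  have key : ∀ c : Pt, (x, y) ∈ (fun e : Pt × Pt => (e.1 + c, e.2 + c)) '' preEdges N ↔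
      y ∈ (nbr N (x - c)).map (addRightEmbedding c) := by
    intro c
    rw [Finset.mem_map]
    constructor
    · rintro ⟨⟨p, q⟩, h, he⟩
      obtain ⟨rfl, rfl⟩ := Prod.mk.inj he
      exact ⟨q, by simpa using h, rfl⟩
    · rintro ⟨q, h, rfl⟩
      exact ⟨(x - c, q), mem_nbr.1 h, by simp⟩
  rw [Finset.mem_union, Finset.mem_union, ← key, ← key, mem_nbr, mem_nbr]
  rfl

lemma sum_nbr_succ (N : ℕ) (x : Pt) {R : Type*} [AddCommMonoid R] (f : Pt → R) :
    ∑ y ∈ nbr (N + 1) x, f y = ∑ y ∈ nbr N x, f y + ∑ y ∈ nbr N (x - ptA N), f (y + ptA N) +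
      ∑ y ∈ nbr N (x - ptB N), f (y + ptB N) := by
  have h2 : (0 : ℝ) < 2 ^ N := by positivity
  rw [nbr_succ, Finset.sum_union, Finset.sum_union]
  · simp
  · rw [Finset.disjoint_left]
    intro y hy hy'
    simp only [Finset.mem_map, mem_nbr, addRightEmbedding_apply] at hy hy'
    obtain ⟨z, hz, rfl⟩ := hy'
    obtain ⟨h1, h2, h3⟩ := of_mem_preEdges hy
    obtain ⟨h4, h5, -⟩ := of_mem_preEdges hz
    have := coord_bounds h1
    have := coord_bounds h2
    have := coord_bounds h4
    have := coord_bounds h5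
    simp only [coordA_add, coordB_add, coordA_sub, coordB_sub, coordA_ptA, coordB_ptA] at *
    exact h3 (ext_coord (by simp; linarith) (by simp; linarith))
  · rw [Finset.disjoint_left]
    intro y hy hy'
    simp only [Finset.mem_union, Finset.mem_map, mem_nbr, addRightEmbedding_apply] at hy hy'
    obtain ⟨z, hz, rfl⟩ := hy'
    obtain ⟨h4, h5, h6⟩ := of_mem_preEdges hz
    have b4 := coord_bounds h4
    have b5 := coord_bounds h5
    rcases hy with hy | ⟨w, hw, hwz⟩
    · obtain ⟨h1, h2, h3⟩ := of_mem_preEdges hy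
      have := coord_bounds h1
      have := coord_bounds h2
      simp only [coordA_add, coordB_add, coordA_sub, coordB_sub, coordA_ptB, coordB_ptB] at *
      exact h3 (ext_coord (by simp; linarith) (by simp; linarith))
    · obtain ⟨h1, h2, h3⟩ := of_mem_preEdges hw
      have := coord_bounds h1
      have := coord_bounds h2
      have eA := congrArg coordA hwz
      have eB := congrArg coordB hwz
      simp only [coordA_add, coordB_add, coordA_sub, coordB_sub, coordA_ptA, coordB_ptA,
        coordA_ptB, coordB_ptB] at *
      exact h6 (ext_coord (by simp; linarith) (by simp; linarith))

lemma sub_ptA_notMem {N : ℕ} {x : Pt} (hx : x ∈ preVerts N) (h : x ≠ ptA N) :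
    x - ptA N ∉ preVerts N := by
  intro h'
  have := coord_bounds hx
  have := coord_bounds h'
  simp only [coordA_sub, coordB_sub, coordA_ptA, coordB_ptA] at *
  exact h (ext_coord (by simp; linarith) (by simp; linarith))

lemma sub_ptB_notMem {N : ℕ} {x : Pt} (hx : x ∈ preVerts N) (h : x ≠ ptB N) :
    x - ptB N ∉ preVerts N := by
  intro h'
  have := coord_bounds hx
  have := coord_bounds h'
  simp only [coordA_sub, coordB_sub, coordA_ptB, coordB_ptB] at *
  exact h (ext_coord (by simp; linarith) (by simp; linarith))

lemma add_ptA_notMem {N : ℕ} {x : Pt} (hx : x ∈ preVerts N) (h : x ≠ ptO) :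
    x + ptA N ∉ preVerts N := by
  intro h'
  have := coord_bounds hx
  have := coord_bounds h'
  simp only [coordA_add, coordB_add, coordA_ptA, coordB_ptA] at *
  exact h (ext_coord (by simp; linarith) (by simp; linarith))

lemma add_ptB_notMem {N : ℕ} {x : Pt} (hx : x ∈ preVerts N) (h : x ≠ ptO) :
    x + ptB N ∉ preVerts N := by
  intro h'
  have := coord_bounds hx
  have := coord_bounds h'
  simp only [coordA_add, coordB_add, coordA_ptB, coordB_ptB] at *
  exact h (ext_coord (by simp; linarith) (by simp; linarith))

lemma add_ptA_sub_ptB_notMem {N : ℕ} {x : Pt} (hx : x ∈ preVerts N) (h : x ≠ ptB N) :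
    x + ptA N - ptB N ∉ preVerts N := by
  intro h'
  have := coord_bounds hx
  have := coord_bounds h'
  simp only [coordA_add, coordB_add, coordA_sub, coordB_sub, coordA_ptA, coordB_ptA, coordA_ptB,
    coordB_ptB] at *
  exact h (ext_coord (by simp; linarith) (by simp; linarith))

lemma add_ptB_sub_ptA_notMem {N : ℕ} {x : Pt} (hx : x ∈ preVerts N) (h : x ≠ ptA N) :
    x + ptB N - ptA N ∉ preVerts N := by
  intro h'
  have := coord_bounds hx
  have := coord_bounds h'
  simp only [coordA_add, coordB_add, coordA_sub, coordB_sub, coordA_ptA, coordB_ptA, coordA_ptB,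
    coordB_ptB] at *
  exact h (ext_coord (by simp; linarith) (by simp; linarith))

lemma ptO_ne_ptA (N : ℕ) : ptO ≠ ptA N := fun h => by
  simpa using congrArg coordA h.symm

lemma ptO_ne_ptB (N : ℕ) : ptO ≠ ptB N := fun h => by
  simpa using congrArg coordB h.symm

lemma ptA_ne_ptB (N : ℕ) : ptA N ≠ ptB N := fun h => by simpa using congrArg coordA h

section sums

variable {R : Type*} [AddCommMonoid R]

lemma sum_nbr_succ_of_left {N : ℕ} {x : Pt} (hx : x ∈ preVerts N) (hA : x ≠ ptA N)
    (hB : x ≠ ptB N) (f : Pt → R) : ∑ y ∈ nbr (N + 1) x, f y = ∑ y ∈ nbr N x, f y := by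
  rw [sum_nbr_succ, nbr_eq_empty (sub_ptA_notMem hx hA), nbr_eq_empty (sub_ptB_notMem hx hB)]
  simp

lemma sum_nbr_succ_of_top {N : ℕ} {x : Pt} (hx : x ∈ preVerts N) (hO : x ≠ ptO)
    (hB : x ≠ ptB N) (f : Pt → R) :
    ∑ y ∈ nbr (N + 1) (x + ptA N), f y = ∑ y ∈ nbr N x, f (y + ptA N) := by
  rw [sum_nbr_succ, nbr_eq_empty (add_ptA_notMem hx hO),
    nbr_eq_empty (add_ptA_sub_ptB_notMem hx hB)]
  simp

lemma sum_nbr_succ_of_right {N : ℕ} {x : Pt} (hx : x ∈ preVerts N) (hO : x ≠ ptO)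
    (hA : x ≠ ptA N) (f : Pt → R) :
    ∑ y ∈ nbr (N + 1) (x + ptB N), f y = ∑ y ∈ nbr N x, f (y + ptB N) := by
  rw [sum_nbr_succ, nbr_eq_empty (add_ptB_notMem hx hO),
    nbr_eq_empty (add_ptB_sub_ptA_notMem hx hA)]
  simp

lemma sum_nbr_succ_ptA (N : ℕ) (f : Pt → R) :
    ∑ y ∈ nbr (N + 1) (ptA N), f y =
      ∑ y ∈ nbr N (ptA N), f y + ∑ y ∈ nbr N ptO, f (y + ptA N) := by
  rw [sum_nbr_succ, nbr_eq_empty (sub_ptB_notMem (ptA_mem_preVerts N) (ptA_ne_ptB N)), sub_self]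
  simp [ptO_eq_zero]

lemma sum_nbr_succ_ptB (N : ℕ) (f : Pt → R) :
    ∑ y ∈ nbr (N + 1) (ptB N), f y =
      ∑ y ∈ nbr N (ptB N), f y + ∑ y ∈ nbr N ptO, f (y + ptB N) := by
  rw [sum_nbr_succ, nbr_eq_empty (sub_ptA_notMem (ptB_mem_preVerts N) (ptA_ne_ptB N).symm),
    sub_self]
  simp [ptO_eq_zero]

lemma sum_nbr_succ_ptA_add_ptB (N : ℕ) (f : Pt → R) :
    ∑ y ∈ nbr (N + 1) (ptA N + ptB N), f y =
      ∑ y ∈ nbr N (ptB N), f (y + ptA N) + ∑ y ∈ nbr N (ptA N), f (y + ptB N) := by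
  rw [sum_nbr_succ, nbr_eq_empty (add_ptB_notMem (ptA_mem_preVerts N) (ptO_ne_ptA N).symm)]
  simp

end sums

lemma preVerts_succ_cases {N : ℕ} {x : Pt} (hx : x ∈ preVerts (N + 1))
    (hc : ¬ IsCorner (N + 1) x) :
    (x ∈ preVerts N ∧ ¬ IsCorner N x) ∨
      (∃ z ∈ preVerts N, ¬ IsCorner N z ∧ x = z + ptA N) ∨
      (∃ z ∈ preVerts N, ¬ IsCorner N z ∧ x = z + ptB N) ∨
      x = ptA N ∨ x = ptB N ∨ x = ptA N + ptB N := by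
  have h0 : ∀ c : Pt, ptO + c = c := fun c => by simp [ptO_eq_zero]
  simp only [IsCorner, ptA_succ, ptB_succ] at hc ⊢
  rcases hx with (hx | ⟨z, hz, rfl⟩) | ⟨z, hz, rfl⟩
  · tauto
  · by_cases h : z = ptO ∨ z = ptA N ∨ z = ptB N
    · rcases h with rfl | rfl | rfl
      · simp [h0]
      · simp at hc
      · simp [add_comm]
    · exact Or.inr (Or.inl ⟨z, hz, h, rfl⟩)
  · by_cases h : z = ptO ∨ z = ptA N ∨ z = ptB N
    · rcases h with rfl | rfl | rfl
      · simp [h0]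
      · simp
      · simp at hc
    · exact Or.inr (Or.inr (Or.inl ⟨z, hz, h, rfl⟩))

lemma card_nbr_corner (N : ℕ) :
    (nbr N ptO).card = 2 ∧ (nbr N (ptA N)).card = 2 ∧ (nbr N (ptB N)).card = 2 := by
  have hOA := ptO_ne_ptA
  have hOB := ptO_ne_ptB
  have hAB := ptA_ne_ptB
  induction N with
  | zero =>
    have e1 : nbr 0 ptO = {ptA 0, ptB 0} := by
      ext y; simp [preEdges, hOA, hOB]
    have e2 : nbr 0 (ptA 0) = {ptO, ptB 0} := by
      ext y; simp [preEdges, (hOA 0).symm, hAB]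
    have e3 : nbr 0 (ptB 0) = {ptO, ptA 0} := by
      ext y; simp [preEdges, (hOB 0).symm, (hAB 0).symm]
    rw [e1, e2, e3]
    exact ⟨Finset.card_pair (hAB 0), Finset.card_pair (hOB 0), Finset.card_pair (hOA 0)⟩
  | succ N ih =>
    simp only [Finset.card_eq_sum_ones] at ih ⊢
    rw [ptA_succ, ptB_succ, sum_nbr_succ_of_left (ptO_mem_preVerts N) (hOA N) (hOB N),
      sum_nbr_succ_of_top (ptA_mem_preVerts N) (hOA N).symm (hAB N),
      sum_nbr_succ_of_right (ptB_mem_preVerts N) (hOB N).symm (hAB N).symm]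
    exact ih

lemma card_nbr {N : ℕ} {x : Pt} (hx : x ∈ preVerts N) (hc : ¬ IsCorner N x) :
    (nbr N x).card = 4 := by
  induction N generalizing x with
  | zero => exact absurd hx hc
  | succ N ih =>
    obtain ⟨cO, cA, cB⟩ := card_nbr_corner N
    rcases preVerts_succ_cases hx hc with
      ⟨h, h'⟩ | ⟨z, hz, h', rfl⟩ | ⟨z, hz, h', rfl⟩ | rfl | rfl | rfl
    · have := ih h h'
      simp only [IsCorner, not_or] at h'
      rwa [Finset.card_eq_sum_ones, sum_nbr_succ_of_left h h'.2.1 h'.2.2,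
        ← Finset.card_eq_sum_ones]
    · have := ih hz h'
      simp only [IsCorner, not_or] at h'
      rwa [Finset.card_eq_sum_ones, sum_nbr_succ_of_top hz h'.1 h'.2.2,
        ← Finset.card_eq_sum_ones]
    · have := ih hz h'
      simp only [IsCorner, not_or] at h'
      rwa [Finset.card_eq_sum_ones, sum_nbr_succ_of_right hz h'.1 h'.2.1,
        ← Finset.card_eq_sum_ones]
    · rw [Finset.card_eq_sum_ones, sum_nbr_succ_ptA, ← Finset.card_eq_sum_ones,
        ← Finset.card_eq_sum_ones, cA, cO]
    · rw [Finset.card_eq_sum_ones, sum_nbr_succ_ptB, ← Finset.card_eq_sum_ones,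
        ← Finset.card_eq_sum_ones, cB, cO]
    · rw [Finset.card_eq_sum_ones, sum_nbr_succ_ptA_add_ptB, ← Finset.card_eq_sum_ones,
        ← Finset.card_eq_sum_ones, cA, cB]

/-- The graph Laplacian of `F'_N`. -/
def lap (N : ℕ) (u : Pt → ℝ) (x : Pt) : ℝ := ∑ y ∈ nbr N x, (u x - u y)

/-- The resistance renormalisation of the gasket: the flux of a function harmonic inside `F'_N`
through a corner is `(3/5)^N` times the flux in a single triangle with the same corner values. -/
lemma lap_corner (N : ℕ) (u : Pt → ℝ)
    (hu : ∀ x ∈ preVerts N, ¬ IsCorner N x → lap N u x = 0) :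
    lap N u ptO = (3 / 5) ^ N * (2 * u ptO - u (ptA N) - u (ptB N)) ∧
    lap N u (ptA N) = (3 / 5) ^ N * (2 * u (ptA N) - u ptO - u (ptB N)) ∧
    lap N u (ptB N) = (3 / 5) ^ N * (2 * u (ptB N) - u ptO - u (ptA N)) := by
  have hOA := ptO_ne_ptA
  have hOB := ptO_ne_ptB
  have hAB := ptA_ne_ptB
  induction N generalizing u with
  | zero =>
    have e1 : nbr 0 ptO = {ptA 0, ptB 0} := by
      ext y; simp [preEdges, hOA, hOB]
    have e2 : nbr 0 (ptA 0) = {ptO, ptB 0} := by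
      ext y; simp [preEdges, (hOA 0).symm, hAB]
    have e3 : nbr 0 (ptB 0) = {ptO, ptA 0} := by
      ext y; simp [preEdges, (hOB 0).symm, (hAB 0).symm]
    simp only [lap, e1, e2, e3, Finset.sum_pair (hAB 0), Finset.sum_pair (hOB 0),
      Finset.sum_pair (hOA 0)]
    refine ⟨?_, ?_, ?_⟩ <;> ring
  | succ N ih =>
    have h0 : ∀ c : Pt, ptO + c = c := fun c => by simp [ptO_eq_zero]
    have bnd : ∀ x ∈ preVerts N, ¬ IsCorner N x →
        coordA x + coordB x < 2 ^ (N + 1) := fun x hx _ => by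
      have := (coord_bounds hx).2.2
      have : (0 : ℝ) < 2 ^ N := by positivity
      rw [pow_succ]; linarith
    have ncL : ∀ x ∈ preVerts N, ¬ IsCorner N x → ¬ IsCorner (N + 1) x := by
      rintro x hx hc (rfl | rfl | rfl)
      · exact hc (Or.inl rfl)
      · simpa using bnd _ hx hc
      · simpa using bnd _ hx hc
    have ncT : ∀ x ∈ preVerts N, ¬ IsCorner N x → ¬ IsCorner (N + 1) (x + ptA N) := by
      rintro x hx hc (h | h | h)
      · have := congrArg coordA h
        have := coord_bounds hx
        have : (0 : ℝ) < 2 ^ N := by positivity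
        simp only [coordA_add, coordA_ptA, coordA_ptO] at *
        linarith
      · rw [ptA_succ, add_left_inj] at h
        exact hc (Or.inr (Or.inl h))
      · have := congrArg coordA h
        have := coord_bounds hx
        have : (0 : ℝ) < 2 ^ N := by positivity
        simp only [coordA_add, coordA_ptA, coordA_ptB] at *
        linarith
    have ncR : ∀ x ∈ preVerts N, ¬ IsCorner N x → ¬ IsCorner (N + 1) (x + ptB N) := by
      rintro x hx hc (h | h | h)
      · have := congrArg coordB h
        have := coord_bounds hx
        have : (0 : ℝ) < 2 ^ N := by positivity
        simp only [coordB_add, coordB_ptB, coordB_ptO] at *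
        linarith
      · have := congrArg coordB h
        have := coord_bounds hx
        have : (0 : ℝ) < 2 ^ N := by positivity
        simp only [coordB_add, coordB_ptA, coordB_ptB] at *
        linarith
      · rw [ptB_succ, add_left_inj] at h
        exact hc (Or.inr (Or.inr h))
    obtain ⟨L1, L2, L3⟩ := ih u fun x hx hc => by
      have := hu x (Or.inl (Or.inl hx)) (ncL x hx hc)
      simp only [IsCorner, not_or] at hc
      rwa [lap, sum_nbr_succ_of_left hx hc.2.1 hc.2.2] at this
    obtain ⟨T1, T2, T3⟩ := ih (fun p => u (p + ptA N)) fun x hx hc => by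
      have := hu (x + ptA N) (Or.inl (Or.inr ⟨x, hx, rfl⟩)) (ncT x hx hc)
      simp only [IsCorner, not_or] at hc
      rwa [lap, sum_nbr_succ_of_top hx hc.1 hc.2.2] at this
    obtain ⟨R1, R2, R3⟩ := ih (fun p => u (p + ptB N)) fun x hx hc => by
      have := hu (x + ptB N) (Or.inr ⟨x, hx, rfl⟩) (ncR x hx hc)
      simp only [IsCorner, not_or] at hc
      rwa [lap, sum_nbr_succ_of_right hx hc.1 hc.2.1] at this
    have p2 : (0 : ℝ) < 2 ^ N := by positivity
    have ha : lap (N + 1) u (ptA N) = 0 := by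
      refine hu _ (Or.inl (Or.inl (ptA_mem_preVerts N))) ?_
      rintro (h | h | h)
      · exact hOA N h.symm
      · have := congrArg coordA h; simp [pow_succ] at this
      · have := congrArg coordA h; simp at this
    have hb : lap (N + 1) u (ptB N) = 0 := by
      refine hu _ (Or.inl (Or.inl (ptB_mem_preVerts N))) ?_
      rintro (h | h | h)
      · exact hOB N h.symm
      · have := congrArg coordB h; simp at this
      · have := congrArg coordB h; simp [pow_succ] at this
    have hm : lap (N + 1) u (ptA N + ptB N) = 0 := by
      refine hu _ (Or.inr ⟨_, ptA_mem_preVerts N, rfl⟩) ?_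
      rintro (h | h | h)
      · have := congrArg coordA h; simp at this
      · have := congrArg coordB h; simp at this
      · have := congrArg coordA h; simp at this
    rw [lap, sum_nbr_succ_ptA] at ha
    rw [lap, sum_nbr_succ_ptB] at hb
    rw [lap, sum_nbr_succ_ptA_add_ptB] at hm
    have gO : lap (N + 1) u ptO = lap N u ptO := by
      rw [lap, sum_nbr_succ_of_left (ptO_mem_preVerts N) (hOA N) (hOB N)]; rfl
    have gA : lap (N + 1) u (ptA (N + 1)) = lap N (fun p => u (p + ptA N)) (ptA N) := by
      rw [lap, ptA_succ, sum_nbr_succ_of_top (ptA_mem_preVerts N) (hOA N).symm (hAB N)]; rfl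
    have gB : lap (N + 1) u (ptB (N + 1)) = lap N (fun p => u (p + ptB N)) (ptB N) := by
      rw [lap, ptB_succ, sum_nbr_succ_of_right (ptB_mem_preVerts N) (hOB N).symm (hAB N).symm]
      rfl
    rw [gO, gA, gB, L1, T2, R3]
    simp only [lap, h0, ← ptA_succ, ← ptB_succ] at L1 L2 L3 T1 T2 T3 R1 R2 R3 ⊢
    rw [add_comm (ptB N) (ptA N)] at *
    rw [L2, T1] at ha
    rw [L3, R1] at hb
    rw [T3, R2] at hm
    have P0 : ((3 : ℝ) / 5) ^ N ≠ 0 := by positivity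
    rw [← mul_add] at ha hb hm
    have ha' := (mul_eq_zero.1 ha).resolve_left P0
    have hb' := (mul_eq_zero.1 hb).resolve_left P0
    have hm' := (mul_eq_zero.1 hm).resolve_left P0
    simp only [pow_succ, mul_assoc]
    refine ⟨?_, ?_, ?_⟩ <;> congr 1 <;> linarith

/-! ### The infinite gasket -/

lemma mem_G0 {x : Pt} : x ∈ G0 ↔ ∃ N, x ∈ preVerts N ∨ reflY x ∈ preVerts N := by
  simp only [G0, Set.mem_iUnion, Set.mem_union]
  refine exists_congr fun N => or_congr_right ⟨?_, fun h => ⟨_, h, reflY_reflY x⟩⟩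
  rintro ⟨y, hy, rfl⟩
  rwa [reflY_reflY]

lemma mem_E0 {x y : Pt} :
    (x, y) ∈ E0 ↔ ∃ N, (x, y) ∈ preEdges N ∨ (reflY x, reflY y) ∈ preEdges N := by
  simp only [E0, Set.mem_iUnion, Set.mem_union]
  refine exists_congr fun N => or_congr_right ⟨?_, fun h => ⟨_, h, by simp⟩⟩
  rintro ⟨⟨p, q⟩, h, he⟩
  obtain ⟨rfl, rfl⟩ := Prod.mk.inj he
  simpa using h

lemma reflY_mem_G0 {x : Pt} : reflY x ∈ G0 ↔ x ∈ G0 := by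
  simp only [mem_G0, reflY_reflY, or_comm]

lemma reflY_mem_E0 {x y : Pt} : (reflY x, reflY y) ∈ E0 ↔ (x, y) ∈ E0 := by
  simp only [mem_E0, reflY_reflY, or_comm]

lemma mem_G0_of_mem_E0 {x y : Pt} (h : (x, y) ∈ E0) : x ∈ G0 ∧ y ∈ G0 := by
  obtain ⟨N, h | h⟩ := mem_E0.1 h
  · exact ⟨mem_G0.2 ⟨N, Or.inl (of_mem_preEdges h).1⟩,
      mem_G0.2 ⟨N, Or.inl (of_mem_preEdges h).2.1⟩⟩
  · exact ⟨mem_G0.2 ⟨N, Or.inr (of_mem_preEdges h).1⟩,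
      mem_G0.2 ⟨N, Or.inr (of_mem_preEdges h).2.1⟩⟩

lemma preVerts_subset_G0 (N : ℕ) : preVerts N ⊆ G0 := fun _ hx => mem_G0.2 ⟨N, Or.inl hx⟩

lemma reflY_notMem_preVerts {N M : ℕ} {x : Pt} (hx : x ∈ preVerts N) (h : x ≠ ptO) :
    reflY x ∉ preVerts M := by
  intro h'
  have := coord_bounds hx
  have := coord_bounds h'
  simp only [coordA_reflY, coordB_reflY] at *
  exact h (ext_coord (by simp; linarith) (by simp; linarith))

lemma ne_ptA_of_lt {N M : ℕ} {x : Pt} (hx : x ∈ preVerts N) (h : N < M) : x ≠ ptA M := by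
  rintro rfl
  have := (coord_bounds hx).2.2
  have : (2 : ℝ) ^ N < 2 ^ M := pow_lt_pow_right₀ (by norm_num) h
  simp at *
  linarith

lemma ne_ptB_of_lt {N M : ℕ} {x : Pt} (hx : x ∈ preVerts N) (h : N < M) : x ≠ ptB M := by
  rintro rfl
  have := (coord_bounds hx).2.2
  have : (2 : ℝ) ^ N < 2 ^ M := pow_lt_pow_right₀ (by norm_num) h
  simp at *
  linarith

lemma nbr_succ_of_left {N : ℕ} {x : Pt} (hx : x ∈ preVerts N) (hA : x ≠ ptA N)
    (hB : x ≠ ptB N) : nbr (N + 1) x = nbr N x := by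
  rw [nbr_succ, nbr_eq_empty (sub_ptA_notMem hx hA), nbr_eq_empty (sub_ptB_notMem hx hB)]
  simp

lemma nbr_eq_of_le {N M : ℕ} {x : Pt} (hx : x ∈ preVerts N) (hA : x ≠ ptA N)
    (hB : x ≠ ptB N) (h : N ≤ M) : nbr M x = nbr N x := by
  induction M, h using Nat.le_induction with
  | base => rfl
  | succ M h ih =>
    rw [← ih]
    rcases h.eq_or_lt with rfl | h
    · exact nbr_succ_of_left hx hA hB
    · exact nbr_succ_of_left (preVerts_mono h.le hx) (ne_ptA_of_lt hx h) (ne_ptB_of_lt hx h)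

lemma exists_mem_preEdges {N : ℕ} {x y : Pt} (hx : x ∈ preVerts N) (hA : x ≠ ptA N)
    (hB : x ≠ ptB N) : (∃ M, (x, y) ∈ preEdges M) ↔ y ∈ nbr N x := by
  refine ⟨?_, fun h => ⟨N, mem_nbr.1 h⟩⟩
  rintro ⟨M, h⟩
  rw [← nbr_eq_of_le hx hA hB (le_max_left N M), mem_nbr]
  exact preEdges_mono (le_max_right N M) h

lemma mem_E0_iff_mem_nbr {N : ℕ} {x : Pt} (hx : x ∈ preVerts N) (hc : ¬ IsCorner N x) (y : Pt) :
    y ∈ nbr N x ↔ (x, y) ∈ E0 := by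
  simp only [IsCorner, not_or] at hc
  rw [← exists_mem_preEdges hx hc.2.1 hc.2.2, mem_E0]
  refine exists_congr fun M => ⟨Or.inl, fun h => h.resolve_right fun h => ?_⟩
  exact reflY_notMem_preVerts hx hc.1 (of_mem_preEdges h).1

lemma mem_E0_ptO (N : ℕ) (y : Pt) :
    y ∈ nbr N ptO ∪ (nbr N ptO).image reflY ↔ (ptO, y) ∈ E0 := by
  have h : y ∈ (nbr N ptO).image reflY ↔ reflY y ∈ nbr N ptO := by
    rw [Finset.mem_image]
    exact ⟨fun ⟨z, hz, h⟩ => by rwa [← h, reflY_reflY], fun h => ⟨_, h, reflY_reflY y⟩⟩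
  rw [Finset.mem_union, h, ← exists_mem_preEdges (ptO_mem_preVerts N) (ptO_ne_ptA N)
    (ptO_ne_ptB N), ← exists_mem_preEdges (ptO_mem_preVerts N) (ptO_ne_ptA N) (ptO_ne_ptB N),
    mem_E0, reflY_ptO, exists_or]

lemma disjoint_nbr_ptO (N : ℕ) : Disjoint (nbr N ptO) ((nbr N ptO).image reflY) := by
  rw [Finset.disjoint_left]
  intro y hy hy'
  obtain ⟨z, hz, rfl⟩ := Finset.mem_image.1 hy'
  obtain ⟨-, h2, h3⟩ := of_mem_preEdges (mem_nbr.1 hz)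
  exact reflY_notMem_preVerts h2 (Ne.symm h3) (of_mem_preEdges (mem_nbr.1 hy)).2.1

lemma not_isCorner_succ {N : ℕ} {x : Pt} (hx : x ∈ preVerts N) (hO : x ≠ ptO) :
    ¬ IsCorner (N + 1) x := by
  rintro (h | h | h)
  · exact hO h
  · exact ne_ptA_of_lt hx N.lt_succ_self h
  · exact ne_ptB_of_lt hx N.lt_succ_self h

/-- Every vertex of the infinite gasket has exactly four neighbours. -/
lemma exists_nbrs {x : Pt} (hx : x ∈ G0) :
    ∃ s : Finset Pt, (∀ y, y ∈ s ↔ (x, y) ∈ E0) ∧ s.card = 4 := by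
  by_cases hO : x = ptO
  · subst hO
    refine ⟨_, mem_E0_ptO 0, ?_⟩
    rw [Finset.card_union_of_disjoint (disjoint_nbr_ptO 0),
      Finset.card_image_of_injective _ reflY_injective, (card_nbr_corner 0).1]
  obtain ⟨N, h | h⟩ := mem_G0.1 hx
  · have hc := not_isCorner_succ h hO
    have h' : x ∈ preVerts (N + 1) := preVerts_mono N.le_succ h
    exact ⟨_, mem_E0_iff_mem_nbr h' hc, card_nbr h' hc⟩
  · have hc := not_isCorner_succ h fun h => hO (by rw [← reflY_reflY x, h, reflY_ptO])
    have h' : reflY x ∈ preVerts (N + 1) := preVerts_mono N.le_succ h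
    refine ⟨(nbr (N + 1) (reflY x)).image reflY, fun y => ?_, ?_⟩
    · rw [← reflY_mem_E0, ← mem_E0_iff_mem_nbr h' hc, Finset.mem_image]
      exact ⟨fun ⟨z, hz, h⟩ => by rwa [← h, reflY_reflY], fun h => ⟨_, h, reflY_reflY y⟩⟩
    · rw [Finset.card_image_of_injective _ reflY_injective, card_nbr h' hc]

lemma mem_G {N : ℕ} {x : Pt} : x ∈ G N ↔ ∃ q ∈ G0, x = ((2 : ℝ) ^ N) • q := by
  simp only [G, Set.mem_image, eq_comm]

lemma smul_reflY (c : ℝ) (q : Pt) : c • reflY q = reflY (c • q) :=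
  Prod.ext (by simp [reflY]) (by simp [reflY])

lemma reflY_mem_G {N : ℕ} {x : Pt} : reflY x ∈ G N ↔ x ∈ G N := by
  have key : ∀ {x : Pt}, x ∈ G N → reflY x ∈ G N := by
    intro x hx
    obtain ⟨q, hq, rfl⟩ := mem_G.1 hx
    exact mem_G.2 ⟨_, reflY_mem_G0.2 hq, (smul_reflY _ _).symm⟩
  exact ⟨fun h => by simpa using key h, key⟩

lemma exists_int_coord_of_mem_G {N : ℕ} {x : Pt} (hx : x ∈ G N) :
    ∃ i j : ℤ, coordA x = 2 ^ N * i ∧ coordB x = 2 ^ N * j := by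
  obtain ⟨q, hq, rfl⟩ := mem_G.1 hx
  obtain ⟨M, h | h⟩ := mem_G0.1 hq
  · obtain ⟨i, j, hi, hj, -⟩ := exists_coord_of_mem_preVerts h
    exact ⟨i, j, by simp [hi], by simp [hj]⟩
  · obtain ⟨i, j, hi, hj, -⟩ := exists_coord_of_mem_preVerts h
    simp only [coordA_reflY, coordB_reflY] at hi hj
    refine ⟨i, -j - i, by simp [hi], ?_⟩
    have : coordB q = -j - i := by linarith
    simp [this]

lemma isCorner_of_int_coord {N : ℕ} {x : Pt} (hx : x ∈ preVerts N) {i j : ℤ}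
    (hi : coordA x = 2 ^ N * i) (hj : coordB x = 2 ^ N * j) : IsCorner N x := by
  obtain ⟨h1, h2, h3⟩ := coord_bounds hx
  have hp : (0 : ℝ) < 2 ^ N := by positivity
  rw [hi] at h1 h3
  rw [hj] at h2 h3
  have i0 : 0 ≤ i := by exact_mod_cast nonneg_of_mul_nonneg_right h1 hp
  have j0 : 0 ≤ j := by exact_mod_cast nonneg_of_mul_nonneg_right h2 hp
  have ij : i + j ≤ 1 := by
    have : (i : ℝ) + j ≤ 1 := by
      by_contra! h
      nlinarith
    exact_mod_cast this
  have : (i = 0 ∧ j = 0) ∨ (i = 1 ∧ j = 0) ∨ (i = 0 ∧ j = 1) := by omega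
  rcases this with ⟨rfl, rfl⟩ | ⟨rfl, rfl⟩ | ⟨rfl, rfl⟩
  · exact Or.inl (ext_coord (by simp [hi]) (by simp [hj]))
  · exact Or.inr (Or.inl (ext_coord (by simp [hi]) (by simp [hj])))
  · exact Or.inr (Or.inr (ext_coord (by simp [hi]) (by simp [hj])))

lemma isCorner_of_mem_G {N : ℕ} {x : Pt} (hx : x ∈ preVerts N) (hG : x ∈ G N) :
    IsCorner N x := by
  obtain ⟨i, j, hi, hj⟩ := exists_int_coord_of_mem_G hG
  exact isCorner_of_int_coord hx hi hj

lemma isCorner_of_add_ptB_mem_G {N : ℕ} {x : Pt} (hx : x ∈ preVerts N)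
    (hG : x + ptB N ∈ G N) : IsCorner N x := by
  obtain ⟨i, j, hi, hj⟩ := exists_int_coord_of_mem_G hG
  simp only [coordA_add, coordB_add, coordA_ptB, coordB_ptB] at hi hj
  exact isCorner_of_int_coord hx (i := i) (j := j - 1) (by linarith) (by push_cast; linarith)

lemma ptO_mem_G (N : ℕ) : ptO ∈ G N :=
  mem_G.2 ⟨ptO, preVerts_subset_G0 0 (ptO_mem_preVerts 0), by simp [ptO_eq_zero]⟩

lemma ptA_mem_G (N : ℕ) : ptA N ∈ G N :=
  mem_G.2 ⟨ptA 0, preVerts_subset_G0 0 (ptA_mem_preVerts 0), (smul_ptA N).symm⟩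

lemma ptB_mem_G (N : ℕ) : ptB N ∈ G N :=
  mem_G.2 ⟨ptB 0, preVerts_subset_G0 0 (ptB_mem_preVerts 0), (smul_ptB N).symm⟩

lemma ptA_add_ptB_mem_G (N : ℕ) : ptA N + ptB N ∈ G N :=
  mem_G.2 ⟨ptA 0 + ptB 0, preVerts_subset_G0 1 (Or.inr ⟨_, ptA_mem_preVerts 0, rfl⟩),
    by rw [smul_add, smul_ptA, smul_ptB]⟩

lemma ptB_add_ptB_mem_G (N : ℕ) : ptB N + ptB N ∈ G N :=
  mem_G.2 ⟨ptB 0 + ptB 0, preVerts_subset_G0 1 (Or.inr ⟨_, ptB_mem_preVerts 0, rfl⟩),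
    by rw [smul_add, smul_ptB]⟩

/-- `u` is harmonic at `x` for the simple random walk on `F_0`. -/
def HarmonicAt (u : Pt → ℝ) (x : Pt) : Prop :=
  ∀ s : Finset Pt, (∀ y, y ∈ s ↔ (x, y) ∈ E0) → ∑ y ∈ s, (u x - u y) = 0

lemma HarmonicAt.comp_reflY {u : Pt → ℝ} {x : Pt} (h : HarmonicAt u (reflY x)) :
    HarmonicAt (u ∘ reflY) x := by
  intro s hs
  have := h (s.image reflY) fun y => by
    rw [← reflY_mem_E0, reflY_reflY, ← hs, Finset.mem_image]
    exact ⟨fun ⟨z, hz, h⟩ => by rwa [← h, reflY_reflY], fun h => ⟨_, h, reflY_reflY y⟩⟩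
  rwa [Finset.sum_image reflY_injective.injOn] at this

lemma HarmonicAt.lap_eq_zero {u : Pt → ℝ} {N : ℕ} {x : Pt} (h : HarmonicAt u x)
    (hx : x ∈ preVerts N) (hc : ¬ IsCorner N x) : lap N u x = 0 :=
  h _ (mem_E0_iff_mem_nbr hx hc)

/-- Mean value property for the star of two `2^N`-triangles around `O`. -/
lemma mean_value_ptO {N : ℕ} {u : Pt → ℝ}
    (hu : ∀ x ∈ G0, x ∉ G N \ {ptO} → HarmonicAt u x) :
    4 * u ptO = u (ptA N) + u (ptB N) + u (reflY (ptA N)) + u (reflY (ptB N)) := by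
  have h1 := (lap_corner N u fun x hx hc => by
    refine (hu x (preVerts_subset_G0 N hx) fun h => hc ?_).lap_eq_zero hx hc
    exact isCorner_of_mem_G hx h.1).1
  have h2 := (lap_corner N (u ∘ reflY) fun x hx hc => by
    refine (hu (reflY x) ?_ fun h => hc ?_).comp_reflY.lap_eq_zero hx hc
    · exact reflY_mem_G0.2 (preVerts_subset_G0 N hx)
    · exact isCorner_of_mem_G hx (reflY_mem_G.1 h.1)).1
  have h3 := hu ptO (preVerts_subset_G0 N (ptO_mem_preVerts N)) (by simp) _ (mem_E0_ptO N)
  rw [Finset.sum_union (disjoint_nbr_ptO N), Finset.sum_image reflY_injective.injOn] at h3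
  simp only [lap, Function.comp_apply, reflY_ptO] at h1 h2
  rw [h1, h2, ← mul_add] at h3
  have := (mul_eq_zero.1 h3).resolve_left (by positivity)
  linarith

/-- Mean value property for the star of two `2^N`-triangles around `b_N`. -/
lemma mean_value_ptB {N : ℕ} {u : Pt → ℝ}
    (hu : ∀ x ∈ G0, x ∉ G N \ {ptB N} → HarmonicAt u x) :
    4 * u (ptB N) = u ptO + u (ptA N) + u (ptA N + ptB N) + u (ptB N + ptB N) := by
  have h1 := (lap_corner N u fun x hx hc => by
    refine (hu x (preVerts_subset_G0 N hx) fun h => hc ?_).lap_eq_zero hx hc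
    exact isCorner_of_mem_G hx h.1).2.2
  have h2 := (lap_corner N (fun p => u (p + ptB N)) fun x hx hc => by
    have hx' : x + ptB N ∈ preVerts (N + 1) := Or.inr ⟨x, hx, rfl⟩
    have hc' : ¬ IsCorner (N + 1) (x + ptB N) := by
      rintro (h | h | h)
      · exact hc (isCorner_of_add_ptB_mem_G hx (h ▸ ptO_mem_G N))
      · have := congrArg coordB h
        have := coord_bounds hx
        have : (0 : ℝ) < 2 ^ N := by positivity
        simp only [coordB_add, coordB_ptA, coordB_ptB] at *
        linarith
      · exact hc (isCorner_of_add_ptB_mem_G hx (h ▸ ptB_succ N ▸ ptB_add_ptB_mem_G N))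
    have := (hu _ (preVerts_subset_G0 _ hx') fun h =>
      hc (isCorner_of_add_ptB_mem_G hx h.1)).lap_eq_zero hx' hc'
    simp only [IsCorner, not_or] at hc
    rwa [lap, sum_nbr_succ_of_right hx hc.1 hc.2.1] at this).1
  have h3 := (hu (ptB N) (preVerts_subset_G0 N (ptB_mem_preVerts N)) (by simp)).lap_eq_zero
    (preVerts_mono N.le_succ (ptB_mem_preVerts N))
    (not_isCorner_succ (ptB_mem_preVerts N) (ptO_ne_ptB N).symm)
  rw [lap, sum_nbr_succ_ptB] at h3
  simp only [lap, ptO_eq_zero, zero_add] at h1 h2 h3 ⊢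
  rw [h1, h2, ← mul_add] at h3
  have := (mul_eq_zero.1 h3).resolve_left (by positivity)
  linarith

/-! ### Masses of sets of stopped paths -/

lemma Path.ext_of_eq {v w : Path} (hX : ∀ i, v.X i = w.X i) (hl : v.len = w.len) : v = w := by
  cases v; cases w
  simp only [Path.mk.injEq]
  exact ⟨funext hX, hl⟩

/-- The path `w` after time `k`, with time restarted. -/
def dropPath (k : ℕ) (w : Path) : Path := ⟨fun i => w.X (i + k), w.len - k⟩

/-- The path `w` preceded by one step from `x`. -/
def consPath (x : Pt) (w : Path) : Path :=
  ⟨fun i => match i with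
    | 0 => x
    | i + 1 => w.X i, w.len + 1⟩

/-- The path of length zero at `t`. -/
def constPath (t : Pt) : Path := ⟨fun _ => t, 0⟩

lemma consPath_dropPath {w : Path} (h : 0 < w.len) : consPath (w.X 0) (dropPath 1 w) = w := by
  refine Path.ext_of_eq (fun i => ?_) (Nat.succ_pred_eq_of_pos h)
  cases i <;> rfl

lemma dropPath_dropPath (k l : ℕ) (w : Path) :
    dropPath k (dropPath l w) = dropPath (k + l) w :=
  Path.ext_of_eq (fun i => congrArg w.X (by omega)) (by simp only [dropPath]; omega)

/-- The total random-walk mass of a set of stopped paths. -/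
def mass (S : Set Path) : ℝ≥0∞ := ∑' w : S, (4⁻¹ : ℝ≥0∞) ^ w.1.len

lemma mass_toReal (S : Set Path) : (mass S).toReal = ∑' w : S, rwWeight w.1 := by
  rw [mass, ENNReal.tsum_toReal_eq fun w => ENNReal.pow_ne_top (by simp)]
  simp [rwWeight]

lemma mass_mono {S T : Set Path} (h : S ⊆ T) : mass S ≤ mass T :=
  ENNReal.tsum_mono_subtype (fun w : Path => (4⁻¹ : ℝ≥0∞) ^ w.len) h

lemma mass_empty : mass ∅ = 0 := by simp [mass]

lemma mass_singleton_constPath (t : Pt) : mass {constPath t} = 1 := by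
  simp [mass, constPath]

/-- First-step decomposition. -/
lemma mass_eq_sum_of_step {S : Set Path} {T : Pt → Set Path} {x : Pt} {s : Finset Pt}
    (hs : ∀ y, y ∈ s ↔ (x, y) ∈ E0) (hT : ∀ y, ∀ w ∈ T y, w.X 0 = y)
    (hS : ∀ w, w ∈ S ↔ w.X 0 = x ∧ 0 < w.len ∧ (x, w.X 1) ∈ E0 ∧ dropPath 1 w ∈ T (w.X 1)) :
    mass S = ∑ y ∈ s, 4⁻¹ * mass (T y) := by
  let e : S ≃ Σ y : s, T y.1 :=
    { toFun := fun w => ⟨⟨w.1.X 1, (hs _).2 ((hS _).1 w.2).2.2.1⟩,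
        ⟨dropPath 1 w.1, ((hS _).1 w.2).2.2.2⟩⟩
      invFun := fun p => ⟨consPath x p.2.1, by
        have h0 : (consPath x p.2.1).X 1 = p.1.1 := hT _ _ p.2.2
        rw [hS, h0]
        exact ⟨rfl, Nat.succ_pos _, (hs _).1 p.1.2, p.2.2⟩⟩
      left_inv := fun w => by
        obtain ⟨w, hw⟩ := w
        have h := (hS w).1 hw
        ext1
        change consPath x (dropPath 1 w) = w
        rw [← h.1, consPath_dropPath h.2.1]
      right_inv := fun p => by
        obtain ⟨⟨y, hy⟩, ⟨w, hw⟩⟩ := p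
        obtain rfl := hT _ _ hw
        rfl }
  rw [mass, ← e.symm.tsum_eq, ENNReal.tsum_sigma', tsum_fintype, ← Finset.sum_coe_sort s]
  refine Finset.sum_congr rfl fun y _ => ?_
  rw [mass, ← ENNReal.tsum_mul_left]
  refine tsum_congr fun w => ?_
  change 4⁻¹ ^ (w.1.len + 1) = _
  rw [pow_succ, mul_comm]

/-- The paths from `x` that walk on `F_0` up to their first visit to `B`, and whose
continuation from then on belongs to `Γ`. -/
def hitThen (B : Set Pt) (Γ : Set Path) (x : Pt) : Set Path :=
  {w | w.X 0 = x ∧ ∃ k ≤ w.len, (∀ i < k, w.X i ∉ B ∧ (w.X i, w.X (i + 1)) ∈ E0) ∧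
    w.X k ∈ B ∧ dropPath k w ∈ Γ}

lemma hitThen_of_mem {B : Set Pt} {Γ : Set Path} {x : Pt} (hx : x ∈ B) :
    hitThen B Γ x = {w ∈ Γ | w.X 0 = x} := by
  ext w
  constructor
  · rintro ⟨rfl, k, -, hk, -, hΓ⟩
    rcases Nat.eq_zero_or_pos k with rfl | hpos
    · exact ⟨hΓ, rfl⟩
    · exact absurd hx (hk 0 hpos).1
  · rintro ⟨hΓ, rfl⟩
    exact ⟨rfl, 0, Nat.zero_le _, by simp, hx, hΓ⟩

lemma mem_hitThen_of_notMem {B : Set Pt} {Γ : Set Path} {x : Pt} (hx : x ∉ B) (w : Path) :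
    w ∈ hitThen B Γ x ↔
      w.X 0 = x ∧ 0 < w.len ∧ (x, w.X 1) ∈ E0 ∧ dropPath 1 w ∈ hitThen B Γ (w.X 1) := by
  constructor
  · rintro ⟨rfl, k, hkl, hk, hB, hΓ⟩
    rcases k with _ | k
    · exact absurd hB hx
    · refine ⟨rfl, by omega, (hk 0 (by omega)).2, rfl, k, ?_, fun i hi => hk (i + 1) (by omega),
        hB, by rwa [dropPath_dropPath]⟩
      simp only [dropPath]; omega
  · rintro ⟨rfl, hpos, hE, -, k, hkl, hk, hB, hΓ⟩
    refine ⟨rfl, k + 1, ?_, fun i hi => ?_, hB, by rwa [dropPath_dropPath] at hΓ⟩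
    · simp only [dropPath] at hkl; omega
    · rcases i with _ | i
      · exact ⟨hx, hE⟩
      · exact hk i (by omega)

lemma sum_le_one {s : Finset Pt} (hc : s.card ≤ 4)
    {f : Pt → ℝ≥0∞} (hf : ∀ y, f y ≤ 1) : ∑ y ∈ s, 4⁻¹ * f y ≤ 1 := by
  calc ∑ y ∈ s, 4⁻¹ * f y ≤ ∑ _y ∈ s, (4⁻¹ : ℝ≥0∞) :=
        Finset.sum_le_sum fun y _ => mul_le_of_le_one_right' (hf y)
    _ = s.card * 4⁻¹ := by simp
    _ ≤ (4 : ℕ) * 4⁻¹ := by gcongr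
    _ = 1 := by exact_mod_cast ENNReal.mul_inv_cancel (by simp) (by simp)

lemma exists_nbrs_le (x : Pt) : ∃ s : Finset Pt, (∀ y, y ∈ s ↔ (x, y) ∈ E0) ∧ s.card ≤ 4 := by
  by_cases hx : x ∈ G0
  · obtain ⟨s, hs, hc⟩ := exists_nbrs hx
    exact ⟨s, hs, hc.le⟩
  · exact ⟨∅, fun y => by simpa using fun h => hx (mem_G0_of_mem_E0 h).1, by simp⟩

lemma mass_hitThen_le_one {B : Set Pt} {Γ : Set Path} (hΓ : ∀ x ∈ B, mass {w ∈ Γ | w.X 0 = x} ≤ 1)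
    (x : Pt) : mass (hitThen B Γ x) ≤ 1 := by
  have trunc : ∀ n x, mass {w ∈ hitThen B Γ x | w.len ≤ n} ≤ 1 := by
    have base : ∀ n, ∀ x ∈ B, mass {w ∈ hitThen B Γ x | w.len ≤ n} ≤ 1 := fun n x hx => by
      have h := hΓ x hx
      rw [← hitThen_of_mem hx] at h
      exact (mass_mono (Set.sep_subset _ _)).trans h
    intro n
    induction n with
    | zero =>
      intro x
      by_cases hx : x ∈ B
      · exact base 0 x hx
      · have : {w ∈ hitThen B Γ x | w.len ≤ 0} = ∅ := by
          refine Set.eq_empty_of_forall_notMem fun w hw => ?_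
          have := ((mem_hitThen_of_notMem hx w).1 hw.1).2.1
          have := hw.2
          omega
        rw [this, mass_empty]
        exact zero_le_one
    | succ n ih =>
      intro x
      by_cases hx : x ∈ B
      · exact base _ x hx
      · obtain ⟨s, hs, hc⟩ := exists_nbrs_le x
        rw [mass_eq_sum_of_step (T := fun y => {w ∈ hitThen B Γ y | w.len ≤ n}) hs
          (fun y w hw => hw.1.1)]
        · exact sum_le_one hc ih
        · intro w
          simp only [Set.mem_ofPred_eq, mem_hitThen_of_notMem hx w, dropPath]
          constructor
          · rintro ⟨⟨h1, h2, h3, h4⟩, h5⟩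
            exact ⟨h1, h2, h3, h4, by omega⟩
          · rintro ⟨h1, h2, h3, h4, h5⟩
            exact ⟨⟨h1, h2, h3, h4⟩, by omega⟩
  rw [mass, ENNReal.tsum_eq_iSup_sum]
  refine iSup_le fun F => ?_
  refine le_trans ?_ (trunc (F.sup fun w => w.1.len) x)
  let ι : F → {w ∈ hitThen B Γ x | w.len ≤ F.sup fun w => w.1.len} := fun w =>
    ⟨w.1.1, w.1.2, Finset.le_sup (f := fun w : hitThen B Γ x => w.1.len) w.2⟩
  have hι : Function.Injective ι := fun v w h =>
    Subtype.ext (Subtype.ext (congrArg (fun z => z.1) h))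
  rw [← Finset.sum_coe_sort F, ← tsum_fintype (L := .unconditional _)]
  exact ENNReal.tsum_comp_le_tsum_of_injective hι
    fun w : {w ∈ hitThen B Γ x | w.len ≤ F.sup fun w => w.1.len} => (4⁻¹ : ℝ≥0∞) ^ w.1.len

lemma harmonicAt_mass_hitThen {B : Set Pt} {Γ : Set Path}
    (hΓ : ∀ x ∈ B, mass {w ∈ Γ | w.X 0 = x} ≤ 1) {x : Pt} (hx : x ∈ G0) (hB : x ∉ B) :
    HarmonicAt (fun x => (mass (hitThen B Γ x)).toReal) x := by
  intro s hs
  obtain ⟨s', hs', hc⟩ := exists_nbrs hx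
  obtain rfl : s = s' := Finset.ext fun y => (hs y).trans (hs' y).symm
  have h := congrArg ENNReal.toReal
    (mass_eq_sum_of_step hs (fun y w hw => hw.1) (mem_hitThen_of_notMem (Γ := Γ) hB))
  have fin : ∀ y, mass (hitThen B Γ y) ≠ ⊤ := fun y =>
    ne_top_of_le_ne_top ENNReal.one_ne_top (mass_hitThen_le_one hΓ y)
  rw [ENNReal.toReal_sum fun y _ => ENNReal.mul_ne_top (by simp) (fin y)] at h
  simp only [ENNReal.toReal_mul, ENNReal.toReal_inv, ENNReal.toReal_ofNat,
    ← Finset.mul_sum] at h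
  rw [Finset.sum_sub_distrib, Finset.sum_const, hc, nsmul_eq_mul]
  beta_reduce
  rw [h]
  push_cast
  ring

lemma mass_sep_constPath (t x : Pt) :
    mass {w ∈ ({constPath t} : Set Path) | w.X 0 = x} = if x = t then 1 else 0 := by
  split_ifs with h
  · subst h
    rw [← mass_singleton_constPath x]
    congr 1
    ext w
    simp only [Set.mem_ofPred_eq, Set.mem_singleton_iff, and_iff_left_iff_imp]
    rintro rfl
    rfl
  · rw [← mass_empty]
    congr 1
    refine Set.eq_empty_of_forall_notMem ?_
    rintro w ⟨rfl, hw⟩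
    exact h hw.symm

lemma mass_sep_hitThen (B : Set Pt) (Γ : Set Path) (t x : Pt) :
    mass {w ∈ hitThen B Γ t | w.X 0 = x} = if x = t then mass (hitThen B Γ t) else 0 := by
  split_ifs with h
  · subst h
    congr 1
    ext w
    exact ⟨fun h => h.1, fun h => ⟨h, h.1⟩⟩
  · rw [← mass_empty]
    congr 1
    refine Set.eq_empty_of_forall_notMem ?_
    rintro w ⟨hw, hw'⟩
    exact h (hw'.symm.trans hw.1)

/-! ### Exit distributions -/

/-- The vertices of `G_N` other than `c`. -/
def others (N : ℕ) (c : Pt) : Set Pt := G N \ {c}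

lemma reflY_ptA_ne (N : ℕ) : reflY (ptA N) ≠ ptO ∧ reflY (ptA N) ≠ ptA N ∧
    reflY (ptA N) ≠ ptB N := by
  have : (0 : ℝ) < 2 ^ N := by positivity
  refine ⟨fun h => ?_, fun h => ?_, fun h => ?_⟩ <;> have := congrArg coordB h <;>
    simp only [coordB_reflY, coordA_ptA, coordB_ptA, coordB_ptB, coordB_ptO] at this <;> linarith

lemma reflY_ptB_ne (N : ℕ) : reflY (ptB N) ≠ ptO ∧ reflY (ptB N) ≠ ptA N ∧
    reflY (ptB N) ≠ ptB N := by
  have : (0 : ℝ) < 2 ^ N := by positivity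
  refine ⟨fun h => ?_, fun h => ?_, fun h => ?_⟩ <;> have := congrArg coordB h <;>
    simp only [coordB_reflY, coordA_ptB, coordB_ptB, coordB_ptA, coordB_ptO] at this <;> linarith

lemma four_mul_mass_hitThen_ptO {N : ℕ} {Γ : Set Path}
    (hΓ : ∀ x ∈ others N ptO, mass {w ∈ Γ | w.X 0 = x} ≤ 1) :
    4 * (mass (hitThen (others N ptO) Γ ptO)).toReal =
      (mass {w ∈ Γ | w.X 0 = ptA N}).toReal + (mass {w ∈ Γ | w.X 0 = ptB N}).toReal +
      (mass {w ∈ Γ | w.X 0 = reflY (ptA N)}).toReal +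
      (mass {w ∈ Γ | w.X 0 = reflY (ptB N)}).toReal := by
  rw [mean_value_ptO (N := N) (u := fun x => (mass (hitThen (others N ptO) Γ x)).toReal)
    fun x hx hB => harmonicAt_mass_hitThen hΓ hx hB, hitThen_of_mem, hitThen_of_mem,
    hitThen_of_mem, hitThen_of_mem]
  · exact ⟨reflY_mem_G.2 (ptB_mem_G N), (reflY_ptB_ne N).1⟩
  · exact ⟨reflY_mem_G.2 (ptA_mem_G N), (reflY_ptA_ne N).1⟩
  · exact ⟨ptB_mem_G N, (ptO_ne_ptB N).symm⟩
  · exact ⟨ptA_mem_G N, (ptO_ne_ptA N).symm⟩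

lemma mass_sep_constPath_le_one (t x : Pt) :
    mass {w ∈ ({constPath t} : Set Path) | w.X 0 = x} ≤ 1 := by
  rw [mass_sep_constPath]
  split_ifs <;> simp

lemma mass_hitThen_ptO_ptA (N : ℕ) :
    (mass (hitThen (others N ptO) {constPath (ptA N)} ptO)).toReal = 1 / 4 := by
  have h := four_mul_mass_hitThen_ptO (N := N) fun x _ => mass_sep_constPath_le_one (ptA N) x
  simp only [mass_sep_constPath, if_neg (ptA_ne_ptB N).symm, if_neg (reflY_ptA_ne N).2.1,
    if_neg (reflY_ptB_ne N).2.1, if_true, ENNReal.toReal_one, ENNReal.toReal_zero] at h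
  linarith

lemma mass_hitThen_ptB_ptA (N : ℕ) :
    (mass (hitThen (others N (ptB N)) {constPath (ptA N)} (ptB N))).toReal = 1 / 4 := by
  have n1 : ptA N + ptB N ≠ ptA N := fun h => by simpa using congrArg coordB h
  have n2 : ptB N + ptB N ≠ ptA N := fun h => by simpa using congrArg coordB h
  have n3 : ptA N + ptB N ≠ ptB N := fun h => by simpa using congrArg coordA h
  have n4 : ptB N + ptB N ≠ ptB N := fun h => by simpa using congrArg coordB h
  have h := mean_value_ptB (N := N)
    (u := fun x => (mass (hitThen (others N (ptB N)) {constPath (ptA N)} x)).toReal)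
    fun x hx hB => harmonicAt_mass_hitThen (fun x _ => mass_sep_constPath_le_one _ x) hx hB
  rw [hitThen_of_mem (B := others N (ptB N)) (x := ptO) ⟨ptO_mem_G N, ptO_ne_ptB N⟩,
    hitThen_of_mem (B := others N (ptB N)) (x := ptA N)
      ⟨ptA_mem_G N, ptA_ne_ptB N⟩,
    hitThen_of_mem (B := others N (ptB N)) (x := ptA N + ptB N)
      ⟨ptA_add_ptB_mem_G N, n3⟩,
    hitThen_of_mem (B := others N (ptB N)) (x := ptB N + ptB N)
      ⟨ptB_add_ptB_mem_G N, n4⟩] at h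
  simp only [mass_sep_constPath, if_neg (ptO_ne_ptA N), if_neg n1, if_neg n2, if_true,
    ENNReal.toReal_one, ENNReal.toReal_zero] at h
  linarith

lemma mass_hitThen_ptO_ptB_ptA (N : ℕ) :
    (mass (hitThen (others N ptO)
      (hitThen (others N (ptB N)) {constPath (ptA N)} (ptB N)) ptO)).toReal = 1 / 16 := by
  have h := four_mul_mass_hitThen_ptO (N := N)
    (Γ := hitThen (others N (ptB N)) {constPath (ptA N)} (ptB N)) fun x _ => by
      rw [mass_sep_hitThen]
      split_ifs
      · exact mass_hitThen_le_one (fun x _ => mass_sep_constPath_le_one _ x) _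
      · exact zero_le_one
  simp only [mass_sep_hitThen, if_neg (ptA_ne_ptB N), if_neg (reflY_ptA_ne N).2.2,
    if_neg (reflY_ptB_ne N).2.2, if_true, ENNReal.toReal_zero, mass_hitThen_ptB_ptA] at h
  linarith

/-! ### Walks stopped at hitting times -/

lemma dropPath_eq_constPath {w : Path} {k : ℕ} {t : Pt} (hk : k ≤ w.len) :
    dropPath k w = constPath t ↔ k = w.len ∧ w.X w.len = t ∧ ∀ i, w.len ≤ i → w.X i = w.X w.len := by
  constructor
  · intro h
    have hl : w.len - k = 0 := congrArg Path.len h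
    have hX : ∀ i, w.X (i + k) = t := fun i => congrArg (fun v => v.X i) h
    obtain rfl : k = w.len := by omega
    have ht : w.X w.len = t := by simpa using hX 0
    refine ⟨rfl, ht, fun i hi => ?_⟩
    rw [ht, ← hX (i - w.len), Nat.sub_add_cancel hi]
  · rintro ⟨rfl, rfl, h⟩
    exact Path.ext_of_eq (fun i => h _ (by omega)) (by simp [dropPath, constPath])

lemma isWalk_iff {w : Path} : IsWalk w ↔ w.X 0 = ptO ∧
    (∀ i, i < w.len → (w.X i, w.X (i + 1)) ∈ E0) ∧ (∀ i, w.len ≤ i → w.X i = w.X w.len) := by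
  refine ⟨fun ⟨h1, _, h3, h4⟩ => ⟨h1, h3, h4⟩, fun ⟨h1, h3, h4⟩ => ⟨h1, fun i hi => ?_, h3, h4⟩⟩
  rcases i with _ | i
  · rw [h1]
    exact preVerts_subset_G0 0 (ptO_mem_preVerts 0)
  · exact (mem_G0_of_mem_E0 (h3 i hi)).2

lemma hitT_zero {N : ℕ} {w : Path} (h0 : w.X 0 = ptO) : hitT N w 0 = 0 := by
  rw [hitT]
  exact Nat.sInf_eq_zero.2 (Or.inl (by simpa [h0] using ptO_mem_G N))

lemma eq_sInf_iff {S : Set ℕ} {k : ℕ} (hk : k ∈ S) : k = sInf S ↔ ∀ i < k, i ∉ S :=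
  ⟨fun h _ hi => Nat.notMem_of_lt_sInf (h ▸ hi), fun h =>
    (le_of_not_gt fun hlt => h _ hlt (Nat.sInf_mem ⟨k, hk⟩)).antisymm (Nat.sInf_le hk)⟩

lemma eq_hitT_one {N : ℕ} {w : Path} (h0 : w.X 0 = ptO) {k : ℕ}
    (hk : w.X k ∈ others N ptO) : k = hitT N w 1 ↔ ∀ i < k, w.X i ∉ others N ptO := by
  have e : {j | hitT N w 0 < j ∧ w.X j ∈ G N ∧ w.X j ≠ w.X (hitT N w 0)} =
      {j | w.X j ∈ others N ptO} := by
    ext j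
    rw [Set.mem_ofPred_eq, hitT_zero h0, h0]
    refine ⟨fun h => h.2, fun h => ⟨Nat.pos_of_ne_zero ?_, h⟩⟩
    rintro rfl
    exact h.2 h0
  rw [hitT, e]
  exact eq_sInf_iff hk

lemma eq_hitT_two {N : ℕ} {w : Path} {t : Pt} (h1 : w.X (hitT N w 1) = t) {k : ℕ}
    (hk : hitT N w 1 ≤ k) (hkB : w.X k ∈ others N t) :
    k = hitT N w 2 ↔ ∀ i < k, hitT N w 1 ≤ i → w.X i ∉ others N t := by
  have ne : ∀ {i}, w.X i ∈ others N t → i ≠ hitT N w 1 := by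
    rintro i hi rfl
    exact hi.2 h1
  have hm : k ∈ {j | hitT N w 1 < j ∧ w.X j ∈ G N ∧ w.X j ≠ w.X (hitT N w 1)} :=
    ⟨hk.lt_of_ne' (ne hkB), hkB.1, by rw [h1]; exact hkB.2⟩
  rw [hitT, eq_sInf_iff hm]
  refine forall₂_congr fun i _ => ?_
  rw [Set.mem_ofPred_eq, h1]
  exact ⟨fun h hi hB => h ⟨hi.lt_of_ne' (ne hB), hB⟩, fun h hi => h hi.1.le hi.2⟩

lemma WSet_eq (N : ℕ) : WSet N = hitThen (others N ptO) {constPath (ptA N)} ptO := by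
  have hA : ptA N ∈ others N ptO := ⟨ptA_mem_G N, (ptO_ne_ptA N).symm⟩
  ext w
  simp only [WSet, hitThen, Set.mem_ofPred_eq, Set.mem_singleton_iff, isWalk_iff]
  constructor
  · rintro ⟨⟨h0, hE, hf⟩, hl, hT⟩
    have hB := (eq_hitT_one h0 (hl.symm ▸ hA)).1 hT
    exact ⟨h0, w.len, le_rfl, fun i hi => ⟨hB i hi, hE i hi⟩, hl.symm ▸ hA,
      (dropPath_eq_constPath le_rfl).2 ⟨rfl, hl, hf⟩⟩
  · rintro ⟨h0, k, hkl, hk, hB, hd⟩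
    obtain ⟨rfl, hl, hf⟩ := (dropPath_eq_constPath hkl).1 hd
    exact ⟨⟨h0, fun i hi => (hk i hi).2, hf⟩, hl, (eq_hitT_one h0 hB).2 fun i hi => (hk i hi).1⟩

lemma VSet_eq (N : ℕ) : VSet N = hitThen (others N ptO)
    (hitThen (others N (ptB N)) {constPath (ptA N)} (ptB N)) ptO := by
  have hA : ptA N ∈ others N (ptB N) := ⟨ptA_mem_G N, ptA_ne_ptB N⟩
  have hBO : ptB N ∈ others N ptO := ⟨ptB_mem_G N, (ptO_ne_ptB N).symm⟩
  ext w
  constructor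
  · rintro ⟨hw, h1, hl, hT⟩
    obtain ⟨h0, hE, hf⟩ := isWalk_iff.1 hw
    have hle : hitT N w 1 ≤ w.len := by
      by_contra! hlt
      rcases Set.eq_empty_or_nonempty
        {j | hitT N w 1 < j ∧ w.X j ∈ G N ∧ w.X j ≠ w.X (hitT N w 1)} with he | hne
      · rw [hitT, he, Nat.sInf_empty] at hT
        rw [hT, h0] at hl
        exact ptO_ne_ptA N hl
      · have : hitT N w 1 < hitT N w 2 := (Nat.sInf_mem hne).1
        omega
    have hB1 := (eq_hitT_one h0 (h1.symm ▸ hBO)).1 rfl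
    have hB2 := (eq_hitT_two h1 hle (hl.symm ▸ hA)).1 hT
    refine ⟨h0, hitT N w 1, hle, fun i hi => ⟨hB1 i hi, hE i (by omega)⟩, h1.symm ▸ hBO, ?_⟩
    refine ⟨by simpa [dropPath] using h1, w.len - hitT N w 1, le_rfl, fun i hi => ?_, ?_, ?_⟩
    · have := hE (i + hitT N w 1) (by omega)
      rw [add_right_comm] at this
      exact ⟨hB2 _ (by omega) (by omega), this⟩
    · simpa only [dropPath, Nat.sub_add_cancel hle, hl] using hA
    · rw [dropPath_dropPath, Nat.sub_add_cancel hle]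
      exact (dropPath_eq_constPath le_rfl).2 ⟨rfl, hl, hf⟩
  · rintro ⟨h0, k, hkl, hk, hkB, hkb, l, hl, hlB, hlA, hd⟩
    simp only [dropPath, zero_add] at hkb hl hlB hlA
    rw [Set.mem_singleton_iff, dropPath_dropPath] at hd
    obtain ⟨hlk, hlen, hf⟩ := (dropPath_eq_constPath (by omega)).1 hd
    have hk1 : k = hitT N w 1 := (eq_hitT_one h0 hkB).2 fun i hi => (hk i hi).1
    subst hk1
    refine ⟨isWalk_iff.2 ⟨h0, fun i hi => ?_, hf⟩, hkb, hlen, ?_⟩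
    · rcases lt_or_ge i (hitT N w 1) with h | h
      · exact (hk i h).2
      · have := (hlB (i - hitT N w 1) (by omega)).2
        rwa [add_right_comm, Nat.sub_add_cancel h] at this
    · refine (eq_hitT_two hkb hkl (hlen.symm ▸ hA)).2 fun i hi h => ?_
      have := (hlB (i - hitT N w 1) (by omega)).1
      rwa [Nat.sub_add_cancel h] at this

/-- For every `N`, the simple random walk on the pre-Sierpinski gasket
started at `O` satisfies `P[Z(T_1^N) = a_N] = 1/4` and
`P[Z(T_1^N) = b_N, Z(T_2^N) = a_N] = 1/16`; equivalently, the total cylinder mass of the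
stopped walks realizing these events is `1/4`, resp. `1/16`. -/
theorem statement0 (N : ℕ) :
    (∑' w : WSet N, rwWeight w.1) = 1 / 4 ∧
    (∑' w : VSet N, rwWeight w.1) = 1 / 16 := by
  rw [← mass_toReal, ← mass_toReal, WSet_eq, VSet_eq]
  exact ⟨mass_hitThen_ptO_ptA N, mass_hitThen_ptO_ptB_ptA N⟩

end LERW
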